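/- Let X ⊂ ℙ^r be an integral and non-degenerate projective variety of dimension n over an algebraically closed field of characteristic 0, weakly k-defective, and assume dim σ_{k+n}(X) = (k+n)(n+1)−1 < r (so X is also weakly (k+1)-defective). If the general tangential contact locus Γ_{k+1} consists of k+1 linearly independent linear subspaces, then the general tangential contact locus Γ_k consists of k linearly independent linear subspaces. -/

import Mathlib

noncomputable section

namespace ContactLoci

variable {K : Type*} [Field K] {ι : Type*} [Fintype ι]

/-- Projective space over `K` with homogeneous coordinates indexed by `ι`. -/
abbrev PP (K : Type*) [Field K] (ι : Type*) : Type _ :=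
  Projectivization K (ι → K)

/-- The affine cone over a set of projective points. -/
def coneOf (S : Set (PP K ι)) : Set (ι → K) :=
  ⋃ x ∈ S, (x.submodule : Set (ι → K))

/-- The linear span, in the underlying vector space, of the cone over `S`. -/
def vspan (S : Set (PP K ι)) : Submodule K (ι → K) :=
  Submodule.span K (coneOf S)

/-- The projective linear span of a set of projective points. -/
def projSpan (S : Set (PP K ι)) : Set (PP K ι) :=
  {x | x.submodule ≤ vspan S}

/-- The projective dimension of the linear span of `S` (`-1` for `S = ∅`). -/
def projDim (S : Set (PP K ι)) : ℤ :=
  (Module.finrank K (vspan S) : ℤ) - 1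

/-- A set of projective points is non-degenerate if its linear span is everything. -/
def Nondegenerate (S : Set (PP K ι)) : Prop :=
  vspan S = ⊤

/-- The common zero locus in projective space of a set of polynomials. -/
def zeroLocus (S : Set (MvPolynomial ι K)) : Set (PP K ι) :=
  {x | ∀ f ∈ S, ∀ v ∈ x.submodule, MvPolynomial.eval v f = 0}

/-- Zariski-closed subsets of projective space: common zero loci of sets of
homogeneous polynomials. -/
def IsZClosed (X : Set (PP K ι)) : Prop :=
  ∃ S : Set (MvPolynomial ι K), (∀ f ∈ S, ∃ d : ℕ, f.IsHomogeneous d) ∧ X = zeroLocus S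

/-- Zariski closure. -/
def zclosure (S : Set (PP K ι)) : Set (PP K ι) :=
  ⋂₀ {Y | IsZClosed Y ∧ S ⊆ Y}

/-- Irreducibility with respect to the Zariski topology. -/
def IsZIrreducible (S : Set (PP K ι)) : Prop :=
  S.Nonempty ∧ ∀ Y Z : Set (PP K ι), IsZClosed Y → IsZClosed Z → S ⊆ Y ∪ Z → S ⊆ Y ∨ S ⊆ Z

/-- An integral projective variety: a Zariski-closed irreducible subset. -/
def IsIntegralVariety (X : Set (PP K ι)) : Prop :=
  IsZClosed X ∧ IsZIrreducible X

/-- `C` is an irreducible component of `S`: a maximal irreducible subset of `S`. -/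
def IsZIrredComponent (S C : Set (PP K ι)) : Prop :=
  IsZIrreducible C ∧ C ⊆ S ∧ ∀ D : Set (PP K ι), IsZIrreducible D → D ⊆ S → C ⊆ D → C = D

/-- The dimension of a set: the Krull dimension of the poset of irreducible
Zariski-closed subsets of its Zariski closure (`⊥` for the empty set). -/
def zdim (S : Set (PP K ι)) : WithBot ℕ∞ :=
  Order.krullDim ({Y : Set (PP K ι) // IsZClosed Y ∧ IsZIrreducible Y ∧ Y ⊆ zclosure S})

/-- A property holds at a general point of `X`: it holds away from a proper
Zariski-closed subset. -/
def HoldsGenerically (X : Set (PP K ι)) (P : PP K ι → Prop) : Prop :=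
  ∃ Y : Set (PP K ι), IsZClosed Y ∧ ¬X ⊆ Y ∧ ∀ x ∈ X \ Y, P x

/-- Zero locus of multihomogeneous polynomials in a self-product of projective space. -/
def multiZeroLocus {m : ℕ} (S : Set (MvPolynomial (Fin m × ι) K)) :
    Set (Fin m → PP K ι) :=
  {u | ∀ f ∈ S, ∀ v : Fin m → ι → K, (∀ i, v i ∈ (u i).submodule) →
    MvPolynomial.eval (fun p => v p.1 p.2) f = 0}

/-- Zariski-closed subsets of the `m`-fold self-product of projective space. -/
def IsMultiZClosed {m : ℕ} (T : Set (Fin m → PP K ι)) : Prop :=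
  ∃ S : Set (MvPolynomial (Fin m × ι) K),
    (∀ f ∈ S, ∀ i : Fin m, ∃ d : ℕ,
      MvPolynomial.IsWeightedHomogeneous (fun p : Fin m × ι => if p.1 = i then 1 else 0) f d) ∧
    T = multiZeroLocus S

/-- A property holds for a general `m`-tuple of points of `X`. -/
def HoldsForGeneralTuples (X : Set (PP K ι)) (m : ℕ) (P : (Fin m → PP K ι) → Prop) : Prop :=
  ∃ T : Set (Fin m → PP K ι), IsMultiZClosed T ∧
    (∃ u : Fin m → PP K ι, (∀ i, u i ∈ X) ∧ u ∉ T) ∧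
    ∀ u : Fin m → PP K ι, (∀ i, u i ∈ X) → u ∉ T → P u

/-- The homogeneous vanishing ideal of `X` (as a set of homogeneous polynomials). -/
def homogVanishingIdeal (X : Set (PP K ι)) : Set (MvPolynomial ι K) :=
  {f | (∃ d : ℕ, f.IsHomogeneous d) ∧ ∀ x ∈ X, ∀ v ∈ x.submodule, MvPolynomial.eval v f = 0}

/-- The embedded (projective) tangent space of `X` at `x`. -/
def embTangentSpace (X : Set (PP K ι)) (x : PP K ι) : Set (PP K ι) :=
  {y | ∀ f ∈ homogVanishingIdeal X,
    ∑ i : ι, y.rep i * MvPolynomial.eval x.rep (MvPolynomial.pderiv i f) = 0}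

/-- Smooth points of `X`. -/
def IsSmoothPoint (X : Set (PP K ι)) (x : PP K ι) : Prop :=
  x ∈ X ∧ zdim (embTangentSpace X x) = zdim X

/-- `M_A`: the linear span of the tangent spaces of `X` at the points of `A`. -/
def tangentSpan (X A : Set (PP K ι)) : Set (PP K ι) :=
  projSpan (⋃ a ∈ A, embTangentSpace X a)

/-- The locus of smooth points of `X` at which `M_A` is tangent to `X`. -/
def tangencyLocus (X A : Set (PP K ι)) : Set (PP K ι) :=
  {x | IsSmoothPoint X x ∧ embTangentSpace X x ⊆ tangentSpan X A}

/-- The tangential contact locus of `X` at `A`: the closure of the union of the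
irreducible components of the tangency locus meeting `A`. -/
def contactLocus (X A : Set (PP K ι)) : Set (PP K ι) :=
  zclosure (⋃ C ∈ {C : Set (PP K ι) |
    IsZIrredComponent (tangencyLocus X A) C ∧ (C ∩ A).Nonempty}, C)

/-- `X` is weakly `k`-defective: the tangential contact locus at `k` general points
has positive dimension. -/
def WeaklyDefective (X : Set (PP K ι)) (k : ℕ) : Prop :=
  HoldsForGeneralTuples X k fun u => 0 < zdim (contactLocus X (Set.range u))

/-- The `k`-th secant variety of `X`. -/
def secant (k : ℕ) (X : Set (PP K ι)) : Set (PP K ι) :=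
  zclosure {q | ∃ S : Finset (PP K ι), ↑S ⊆ X ∧ S.card = k ∧ q ∈ projSpan (S : Set (PP K ι))}

/-- The `X`-rank of a point. -/
def xrank (X : Set (PP K ι)) (q : PP K ι) : ℕ :=
  sInf {k | ∃ S : Finset (PP K ι), ↑S ⊆ X ∧ S.card = k ∧ q ∈ projSpan (S : Set (PP K ι))}

/-- `𝒮(q,X)`: the set of minimal `X`-decompositions of `q`. -/
def decompositions (X : Set (PP K ι)) (q : PP K ι) : Set (Finset (PP K ι)) :=
  {S | ↑S ⊆ X ∧ S.card = xrank X q ∧ q ∈ projSpan (S : Set (PP K ι))}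

/-- `X` is `k`-identifiable: a general point of `σ_k(X)` has a unique minimal
decomposition. -/
def Identifiable (X : Set (PP K ι)) (k : ℕ) : Prop :=
  HoldsGenerically (secant k X) fun q => ∃! S : Finset (PP K ι), S ∈ decompositions X q

/-- `α` is the `k`-th secant degree of `X`. -/
def HasSecantDegree (X : Set (PP K ι)) (k α : ℕ) : Prop :=
  HoldsGenerically (secant k X) fun q => (decompositions X q).ncard = α

/-- Projective linear subspaces. -/
def IsProjLinear (L : Set (PP K ι)) : Prop :=
  L = projSpan L

/-- Lines in projective space. -/
def IsLine (L : Set (PP K ι)) : Prop :=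
  IsProjLinear L ∧ Module.finrank K (vspan L) = 2

/-- `X` is uniruled by lines: through a general point of `X` there is a line
contained in `X`. -/
def UniruledByLines (X : Set (PP K ι)) : Prop :=
  HoldsGenerically X fun x => ∃ L : Set (PP K ι), IsLine L ∧ x ∈ L ∧ L ⊆ X

/-- The join of two sets in projective space. -/
def join (A B : Set (PP K ι)) : Set (PP K ι) :=
  zclosure (⋃ a ∈ A, ⋃ b ∈ B, projSpan {a, b})

/-- The linear space `M` is tangent to `X` along `W`. -/
def TangentAlong (M X W : Set (PP K ι)) : Prop :=
  ∀ x ∈ W, IsSmoothPoint X x → embTangentSpace X x ⊆ M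

/-- `S` has exactly `m` irreducible components, all of them projective linear
subspaces, and these components are linearly independent. -/
def ComponentsAreIndepLinear (S : Set (PP K ι)) (m : ℕ) : Prop :=
  ∃ C : Fin m → Set (PP K ι), Function.Injective C ∧
    (∀ D : Set (PP K ι), IsZIrredComponent S D ↔ ∃ i, D = C i) ∧
    (∀ i, IsProjLinear (C i)) ∧
    Module.finrank K (vspan S) = ∑ i, Module.finrank K (vspan (C i))


/-- The Segre variety: the image of `ℙ^{n 1} × ⋯ × ℙ^{n s}` under the Segre
embedding, given by the complete linear system `|O(1,…,1)|`. -/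
def segreVariety (K : Type*) [Field K] (s : ℕ) (n : Fin s → ℕ) :
    Set (PP K (∀ i : Fin s, Fin (n i + 1))) :=
  {x | ∃ u : ∀ i : Fin s, Fin (n i + 1) → K,
    x.submodule = Submodule.span K
      ({fun t => ∏ i, u i (t i)} : Set ((∀ i : Fin s, Fin (n i + 1)) → K))}

/-- The projection of `L ⊆ Segre` to the `i`-th factor is a single point, i.e. `L`
lies in a single fiber of the `i`-th projection. -/
def SegreFactorIsPoint (K : Type*) [Field K] (s : ℕ) (n : Fin s → ℕ) (i : Fin s)
    (L : Set (PP K (∀ j : Fin s, Fin (n j + 1)))) : Prop :=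
  ∃ w : Fin (n i + 1) → K, w ≠ 0 ∧ ∀ x ∈ L,
    ∃ u : ∀ j : Fin s, Fin (n j + 1) → K,
      x.submodule = Submodule.span K
        ({fun t => ∏ j, u j (t j)} : Set ((∀ j : Fin s, Fin (n j + 1)) → K)) ∧
      u i ∈ Submodule.span K ({w} : Set (Fin (n i + 1) → K))

/-- Index type for the Segre–Veronese embedding of multidegree `d`:
multi-indices of degree `d i` in the homogeneous variables of the `i`-th factor. -/
abbrev svIndex (s : ℕ) (n d : Fin s → ℕ) : Type :=
  ∀ i : Fin s, {w : Fin (n i + 1) → Fin (d i + 1) // ∑ j, (w j : ℕ) = d i}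

/-- The Segre–Veronese variety of multidegree `d`: the image of
`ℙ^{n 1} × ⋯ × ℙ^{n s}` under the embedding by `|L_1^{d 1} ⊗ ⋯ ⊗ L_s^{d s}|`. -/
def segreVeroneseVariety (K : Type*) [Field K] (s : ℕ) (n d : Fin s → ℕ) :
    Set (PP K (svIndex s n d)) :=
  {x | ∃ u : ∀ i : Fin s, Fin (n i + 1) → K,
    x.submodule = Submodule.span K
      ({fun t => ∏ i, ∏ j, u i j ^ ((t i).1 j : ℕ)} : Set (svIndex s n d → K))}

/-- The vector of the moments of degree `≤ d` of the one-dimensional Gaussian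
distribution with mean `μ` and variance `t`. -/
def gaussMomentVec (K : Type*) [Field K] (d : ℕ) (μ t : K) : Fin (d + 1) → K := fun i =>
  ∑ j ∈ Finset.range ((i : ℕ) / 2 + 1),
    ((Nat.choose (i : ℕ) (2 * j) * Nat.doubleFactorial (2 * j - 1) : ℕ) : K) *
      t ^ j * μ ^ ((i : ℕ) - 2 * j)

/-- The Gaussian moment variety `𝒢_{1,d} ⊆ ℙ^d`. -/
def gaussianMomentVariety (K : Type*) [Field K] (d : ℕ) : Set (PP K (Fin (d + 1))) :=
  zclosure {x | ∃ μ t : K,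
    x.submodule = Submodule.span K ({gaussMomentVec K d μ t} : Set (Fin (d + 1) → K))}

/-- Zariski-closed families of `m`-tuples of coefficient vectors of linear forms. -/
def IsAffineClosedFamily {m : ℕ} (T : Set (Fin m → ι → K)) : Prop :=
  ∃ S : Set (MvPolynomial (Fin m × ι) K),
    T = {h | ∀ f ∈ S, MvPolynomial.eval (fun p => h p.1 p.2) f = 0}

/-- The linear subspace cut out by the `m` linear forms with coefficient vectors `h`. -/
def linearSlice {m : ℕ} (h : Fin m → ι → K) : Set (PP K ι) :=
  {x | ∀ j : Fin m, ∑ i : ι, h j i * x.rep i = 0}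

/-- `x` lies on the hyperplane with coefficient vector `f`. -/
def inHyperplane (f : ι → K) (x : PP K ι) : Prop :=
  ∑ i : ι, f i * x.rep i = 0

/-- `X ⊆ ℙ^r` (of dimension `n`, `r + 1 = card ι`) is very strange: for a general
codimension-`n` linear subspace `M`, some `r - n + 2` points of `X ∩ M` lie in a
hyperplane of `M`, i.e. in a linear subspace of projective dimension `r - n - 1`. -/
def VeryStrange (n : ℕ) (X : Set (PP K ι)) : Prop :=
  ∃ T : Set (Fin n → ι → K), IsAffineClosedFamily T ∧ (∃ h, h ∉ T) ∧
    ∀ h : Fin n → ι → K, h ∉ T →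
      ∃ A : Finset (PP K ι), ↑A ⊆ X ∩ linearSlice h ∧
        A.card = Fintype.card ι + 1 - n ∧
        Module.finrank K (vspan (A : Set (PP K ι))) ≤ Fintype.card ι - 1 - n



theorem rep_mem (x : PP K ι) : x.rep ∈ x.submodule := by
  rw [Projectivization.submodule_eq]; exact Submodule.mem_span_singleton_self _

theorem mk_of_mem {x : PP K ι} {v : ι → K} (hv : v ∈ x.submodule) (h0 : v ≠ 0) :
    Projectivization.mk K v h0 = x := by
  rw [Projectivization.submodule_eq, Submodule.mem_span_singleton] at hv
  obtain ⟨c, rfl⟩ := hv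
  conv_rhs => rw [← x.mk_rep]
  rw [Projectivization.mk_eq_mk_iff']
  exact ⟨c, rfl⟩

theorem sub_le_iff_of_mem {x : PP K ι} {v : ι → K} (hv : v ∈ x.submodule) (h0 : v ≠ 0)
    (W : Submodule K (ι → K)) : x.submodule ≤ W ↔ v ∈ W := by
  rw [← mk_of_mem hv h0, Projectivization.submodule_mk, Submodule.span_singleton_le_iff_mem]

theorem sub_le_iff (x : PP K ι) (W : Submodule K (ι → K)) : x.submodule ≤ W ↔ x.rep ∈ W :=
  sub_le_iff_of_mem (rep_mem x) x.rep_nonzero W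

/-- projectivization of a submodule -/
def PV (W : Submodule K (ι → K)) : Set (PP K ι) := {x | x.submodule ≤ W}

theorem vspan_PV (W : Submodule K (ι → K)) : vspan (PV W) = W := by
  apply le_antisymm
  · rw [vspan, Submodule.span_le]
    intro v hv
    simp only [coneOf, Set.mem_iUnion] at hv
    obtain ⟨x, hx, hv⟩ := hv
    exact hx hv
  · intro w hw
    by_cases h0 : w = 0
    · subst h0; exact zero_mem _
    apply Submodule.subset_span
    simp only [coneOf, Set.mem_iUnion]
    refine ⟨Projectivization.mk K w h0, ?_, ?_⟩
    · simp only [PV, Set.mem_setOf_eq, Projectivization.submodule_mk]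
      simpa using hw
    · simp [Projectivization.submodule_mk]

theorem vspan_le_iff (S : Set (PP K ι)) (W : Submodule K (ι → K)) : vspan S ≤ W ↔ S ⊆ PV W := by
  rw [vspan, Submodule.span_le]
  simp only [coneOf, Set.iUnion_subset_iff]
  rfl

theorem subset_PV_vspan (S : Set (PP K ι)) : S ⊆ PV (vspan S) := (vspan_le_iff S _).1 le_rfl

theorem PV_mono {W W' : Submodule K (ι → K)} (h : W ≤ W') : PV W ⊆ PV W' := fun _ hx => le_trans hx h

theorem PV_subset_iff {W W' : Submodule K (ι → K)} : PV W ⊆ PV W' ↔ W ≤ W' := by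
  rw [← vspan_le_iff, vspan_PV]

theorem projSpan_eq (S : Set (PP K ι)) : projSpan S = PV (vspan S) := rfl

theorem PV_inj {W W' : Submodule K (ι → K)} (h : PV W = PV W') : W = W' := by
  rw [← vspan_PV W, h, vspan_PV]

theorem mem_PV {x : PP K ι} {W : Submodule K (ι → K)} : x ∈ PV W ↔ x.rep ∈ W := sub_le_iff x W

/-- vanishing ideal of the cone -/
def Ivan (S : Set (PP K ι)) : Ideal (MvPolynomial ι K) where
  carrier := {f | ∀ x ∈ S, ∀ v ∈ x.submodule, MvPolynomial.eval v f = 0}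
  add_mem' := by
    intro a b ha hb x hx v hv
    simp [ha x hx v hv, hb x hx v hv]
  zero_mem' := by intro x hx v hv; simp
  smul_mem' := by
    intro c a ha x hx v hv
    simp [ha x hx v hv]

theorem mem_Ivan {S : Set (PP K ι)} {f : MvPolynomial ι K} :
    f ∈ Ivan S ↔ ∀ x ∈ S, ∀ v ∈ x.submodule, MvPolynomial.eval v f = 0 := Iff.rfl

theorem Ivan_anti {S T : Set (PP K ι)} (h : S ⊆ T) : Ivan T ≤ Ivan S :=
  fun _ hf x hx => hf x (h hx)

/-- weights for multi-homogeneity -/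
def wt {κ τ : Type*} (p : κ → τ) : κ → (τ →₀ ℕ) := fun c => Finsupp.single (p c) 1

theorem grade_aux {κ τ : Type*} (p : κ → τ) (f : MvPolynomial κ K) (v : κ → K)
    (d : τ →₀ ℕ) :
    MvPolynomial.coeff d
      (MvPolynomial.aeval (fun c => MvPolynomial.X (p c) * MvPolynomial.C (v c)) f :
        MvPolynomial τ K) =
      MvPolynomial.eval v (MvPolynomial.weightedHomogeneousComponent (wt p) d f) := by
  classical
  induction f using MvPolynomial.induction_on' with
  | monomial u a =>
    have h1 : (MvPolynomial.aeval (fun c => MvPolynomial.X (p c) * MvPolynomial.C (v c))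
        (MvPolynomial.monomial u a) : MvPolynomial τ K) =
        MvPolynomial.monomial (Finsupp.weight (wt p) u) (a * u.prod fun c e => v c ^ e) := by
      rw [MvPolynomial.aeval_monomial]
      have : (u.prod fun c e => (MvPolynomial.X (p c) * MvPolynomial.C (v c) :
          MvPolynomial τ K) ^ e) =
          MvPolynomial.monomial (Finsupp.weight (wt p) u) (u.prod fun c e => v c ^ e) := by
        rw [Finsupp.weight_apply, Finsupp.sum, Finsupp.prod, Finsupp.prod,
          MvPolynomial.monomial_sum_index u.support (fun c => u c • wt p c)
            (∏ c ∈ u.support, v c ^ u c), map_prod, ← Finset.prod_mul_distrib]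
        refine Finset.prod_congr rfl fun c _ => ?_
        rw [mul_pow, mul_comm, ← map_pow, MvPolynomial.X_pow_eq_monomial]
        simp [wt]
      rw [this]
      simp [MvPolynomial.algebraMap_eq, MvPolynomial.C_mul_monomial]
    rw [h1, MvPolynomial.coeff_monomial]
    have h2 : MvPolynomial.IsWeightedHomogeneous (wt p) (MvPolynomial.monomial u a)
        (Finsupp.weight (wt p) u) := MvPolynomial.isWeightedHomogeneous_monomial _ _ _ rfl
    split_ifs with h
    · rw [← h, h2.weightedHomogeneousComponent_same, MvPolynomial.eval_monomial]
    · rw [h2.weightedHomogeneousComponent_ne _ (Ne.symm h), map_zero]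
  | add f g hf hg =>
    rw [map_add, MvPolynomial.coeff_add, hf, hg, map_add, map_add]

theorem grade_vanish [Infinite K] {κ τ : Type*} (p : κ → τ) (f : MvPolynomial κ K) (v : κ → K)
    (h : ∀ l : τ → K, MvPolynomial.eval (fun c => l (p c) * v c) f = 0) (d : τ →₀ ℕ) :
    MvPolynomial.eval v (MvPolynomial.weightedHomogeneousComponent (wt p) d f) = 0 := by
  rw [← grade_aux]
  have : (MvPolynomial.aeval (fun c => MvPolynomial.X (p c) * MvPolynomial.C (v c)) f :
        MvPolynomial τ K) = 0 := by
    apply MvPolynomial.funext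
    intro l
    rw [map_zero, ← h l]
    rw [← MvPolynomial.coe_aeval_eq_eval, RingHom.coe_coe, ← AlgHom.comp_apply,
      MvPolynomial.comp_aeval, ← MvPolynomial.coe_aeval_eq_eval, RingHom.coe_coe]
    simp
  rw [this]; simp

theorem grade_vanish' {κ τ : Type*} (p : κ → τ) (f : MvPolynomial κ K) (v : κ → K)
    (h : ∀ d, MvPolynomial.eval v (MvPolynomial.weightedHomogeneousComponent (wt p) d f) = 0) :
    MvPolynomial.eval v f = 0 := by
  rw [← MvPolynomial.finsum_weightedHomogeneousComponent (wt p) f]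
  rw [finsum_eq_sum _ (MvPolynomial.weightedHomogeneousComponent_finsupp f), map_sum]
  exact Finset.sum_eq_zero fun d _ => h d

theorem wt_homog {κ τ : Type*} (p : κ → τ) (f : MvPolynomial κ K) (d : τ →₀ ℕ)
    (hf : MvPolynomial.IsWeightedHomogeneous (wt p) f d) (i : τ) [DecidableEq τ] :
    MvPolynomial.IsWeightedHomogeneous (fun c => if p c = i then 1 else 0) f (d i) := by
  intro u hu
  rw [← hf hu]
  rw [Finsupp.weight_apply, Finsupp.weight_apply, Finsupp.sum, Finsupp.sum, Finsupp.finset_sum_apply]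
  refine Finset.sum_congr rfl fun c _ => ?_
  simp [wt, Finsupp.single_apply]

theorem isMultiZClosed_multiZeroLocus [Infinite K] {m : ℕ}
    (S : Set (MvPolynomial (Fin m × ι) K)) : IsMultiZClosed (multiZeroLocus S) := by
  refine ⟨{g | ∃ f ∈ S, ∃ d, g = MvPolynomial.weightedHomogeneousComponent (wt Prod.fst) d f},
    ?_, ?_⟩
  · rintro _ ⟨f, -, d, rfl⟩ i
    exact ⟨d i, wt_homog _ _ _
      (MvPolynomial.weightedHomogeneousComponent_isWeightedHomogeneous d f) i⟩
  · ext u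
    constructor
    · rintro hu _ ⟨f, hf, d, rfl⟩ v hv
      apply grade_vanish
      intro l
      exact hu f hf (fun p i => l p * v p i) (fun p => Submodule.smul_mem _ (l p) (hv p))
    · intro hu f hf v hv
      apply grade_vanish' Prod.fst
      intro d
      exact hu _ ⟨f, hf, d, rfl⟩ v hv

theorem isZClosed_zeroLocus [Infinite K] (S : Set (MvPolynomial ι K)) :
    IsZClosed (zeroLocus S) := by
  refine ⟨{g | ∃ f ∈ S, ∃ d, g = MvPolynomial.weightedHomogeneousComponent
    (wt fun _ : ι => ()) d f}, ?_, ?_⟩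
  · rintro _ ⟨f, -, d, rfl⟩
    refine ⟨d (), ?_⟩
    have := wt_homog _ _ _
      (MvPolynomial.weightedHomogeneousComponent_isWeightedHomogeneous (w := wt fun _ : ι => ()) d f) ()
    simp only [if_true] at this
    exact this
  · ext u
    constructor
    · rintro hu _ ⟨f, hf, d, rfl⟩ v hv
      apply grade_vanish
      intro l
      exact hu f hf (fun i => l () * v i) (Submodule.smul_mem _ (l ()) hv)
    · intro hu f hf v hv
      apply grade_vanish' (fun _ : ι => ())
      intro d
      exact hu _ ⟨f, hf, d, rfl⟩ v hv

theorem IsZClosed.sep {Y : Set (PP K ι)} (hY : IsZClosed Y) {x : PP K ι} (hx : x ∉ Y) :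
    ∃ f ∈ Ivan Y, ∃ v ∈ x.submodule, MvPolynomial.eval v f ≠ 0 := by
  obtain ⟨S, -, rfl⟩ := hY
  simp only [zeroLocus, Set.mem_setOf_eq, not_forall] at hx
  obtain ⟨f, hf, v, hv, h⟩ := hx
  exact ⟨f, fun y hy v hv => hy f hf v hv, v, hv, h⟩

theorem IsZClosed.eq_zeroLocus {Y : Set (PP K ι)} (hY : IsZClosed Y) :
    Y = zeroLocus (Ivan Y : Set (MvPolynomial ι K)) := by
  apply Set.Subset.antisymm
  · intro x hx f hf v hv; exact hf x hx v hv
  · intro x hx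
    by_contra h
    obtain ⟨f, hf, v, hv, h⟩ := hY.sep h
    exact h (hx f hf v hv)

theorem line_mul [Infinite K] (x : PP K ι) (f g : MvPolynomial ι K)
    (hf : ∃ v ∈ x.submodule, MvPolynomial.eval v f ≠ 0)
    (hg : ∃ v ∈ x.submodule, MvPolynomial.eval v g ≠ 0) :
    ∃ v ∈ x.submodule, MvPolynomial.eval v (f * g) ≠ 0 := by
  obtain ⟨v, hv, h1⟩ := hf
  obtain ⟨w, hw, h2⟩ := hg
  rw [Projectivization.submodule_eq, Submodule.mem_span_singleton] at hv hw
  obtain ⟨a, rfl⟩ := hv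
  obtain ⟨b, rfl⟩ := hw
  let ev : MvPolynomial ι K →ₐ[K] Polynomial K :=
    MvPolynomial.aeval fun i => Polynomial.C (x.rep i) * Polynomial.X
  have key : ∀ (t : K) (q : MvPolynomial ι K),
      (ev q).eval t = MvPolynomial.eval (t • x.rep) q := by
    intro t q
    have : ((Polynomial.aeval t).comp ev) = MvPolynomial.aeval (t • x.rep) := by
      apply MvPolynomial.algHom_ext; intro i; simp [ev]; ring
    have := congrArg (fun φ => φ q) this
    rw [AlgHom.comp_apply] at this
    rw [← Polynomial.coe_aeval_eq_eval, this, ← MvPolynomial.coe_aeval_eq_eval]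
    rfl
  have hf0 : ev f ≠ 0 := fun h0 => h1 (by rw [← key, h0]; simp)
  have hg0 : ev g ≠ 0 := fun h0 => h2 (by rw [← key, h0]; simp)
  by_contra hcon
  push Not at hcon
  apply mul_ne_zero hf0 hg0
  apply Polynomial.funext
  intro t
  rw [← map_mul, key, Polynomial.eval_zero]
  exact hcon _ (Submodule.smul_mem _ _ (rep_mem x))

theorem isZClosed_union [Infinite K] {Y Z : Set (PP K ι)} (hY : IsZClosed Y) (hZ : IsZClosed Z) :
    IsZClosed (Y ∪ Z) := by
  have : Y ∪ Z = zeroLocus (Ivan (Y ∪ Z) : Set (MvPolynomial ι K)) := by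
    apply Set.Subset.antisymm
    · intro x hx f hf v hv; exact hf x hx v hv
    · intro x hx
      by_contra h
      rw [Set.mem_union, not_or] at h
      obtain ⟨f, hf, v, hv, h1⟩ := hY.sep h.1
      obtain ⟨g, hg, w, hw, h2⟩ := hZ.sep h.2
      obtain ⟨u, hu, h3⟩ := line_mul x f g ⟨v, hv, h1⟩ ⟨w, hw, h2⟩
      refine h3 (hx (f * g) ?_ u hu)
      intro y hy v hv
      rcases hy with hy | hy
      · simp [hf y hy v hv]
      · simp [hg y hy v hv]
  rw [this]; exact isZClosed_zeroLocus _

theorem isZClosed_sInter [Infinite K] (F : Set (Set (PP K ι))) (hF : ∀ Y ∈ F, IsZClosed Y) :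
    IsZClosed (⋂₀ F) := by
  have : ⋂₀ F = zeroLocus (Ivan (⋂₀ F) : Set (MvPolynomial ι K)) := by
    apply Set.Subset.antisymm
    · intro x hx f hf v hv; exact hf x hx v hv
    · intro x hx Y hY
      by_contra h
      obtain ⟨f, hf, v, hv, h⟩ := (hF Y hY).sep h
      exact h (hx f (Ivan_anti (Set.sInter_subset_of_mem hY) hf) v hv)
  rw [this]; exact isZClosed_zeroLocus _

theorem isZClosed_zclosure [Infinite K] (S : Set (PP K ι)) : IsZClosed (zclosure S) :=
  isZClosed_sInter _ fun _ h => h.1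

theorem subset_zclosure (S : Set (PP K ι)) : S ⊆ zclosure S :=
  Set.subset_sInter fun _ h => h.2

theorem zclosure_min {S Y : Set (PP K ι)} (hY : IsZClosed Y) (h : S ⊆ Y) : zclosure S ⊆ Y :=
  Set.sInter_subset_of_mem ⟨hY, h⟩

theorem zclosure_eq {Y : Set (PP K ι)} (hY : IsZClosed Y) : zclosure Y = Y :=
  (zclosure_min hY subset_rfl).antisymm (subset_zclosure Y)

theorem Ivan_zclosure [Infinite K] (S : Set (PP K ι)) : Ivan (zclosure S) = Ivan S := by
  apply le_antisymm (Ivan_anti (subset_zclosure S))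
  intro f hf x hx v hv
  have := zclosure_min (Y := zeroLocus {f}) (isZClosed_zeroLocus _) (S := S) (by
    rintro y hy g rfl w hw; exact hf y hy w hw) hx
  exact this f rfl v hv

theorem isZClosed_empty [Infinite K] : IsZClosed (∅ : Set (PP K ι)) := by
  have : (∅ : Set (PP K ι)) = zeroLocus {1} := by
    symm
    rw [Set.eq_empty_iff_forall_notMem]
    intro x hx
    have := hx 1 rfl _ (rep_mem x)
    simp at this
  rw [this]; exact isZClosed_zeroLocus _

theorem IsZIrreducible.prime [Infinite K] {S : Set (PP K ι)} (hS : IsZIrreducible S) :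
    (Ivan S).IsPrime := by
  obtain ⟨⟨x0, hx0⟩, h⟩ := hS
  refine ⟨?_, ?_⟩
  · rw [Ideal.ne_top_iff_one]
    intro h1
    have := h1 x0 hx0 _ (rep_mem x0)
    simp at this
  · intro f g hfg
    have hle : ∀ q : MvPolynomial ι K, S ⊆ zeroLocus {q} → q ∈ Ivan S := by
      intro q hq x hx v hv
      exact hq hx q rfl v hv
    have := h (zeroLocus {f}) (zeroLocus {g}) (isZClosed_zeroLocus _) (isZClosed_zeroLocus _) ?_
    · exact this.imp (hle f) (hle g)
    · rw [(isZClosed_union (isZClosed_zeroLocus {f}) (isZClosed_zeroLocus {g})).eq_zeroLocus]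
      have h2 : S ⊆ zeroLocus {f * g} := by
        rintro x hx q rfl v hv; exact hfg x hx v hv
      intro x hx q hq v hv
      by_contra hne
      -- x not in union, so separate
      have hxn : x ∉ zeroLocus {f} ∪ zeroLocus {g} := fun hxu => hne (hq x hxu v hv)
      rw [Set.mem_union, not_or] at hxn
      obtain ⟨hxf, hxg⟩ := hxn
      simp only [zeroLocus, Set.mem_singleton_iff, forall_eq, Set.mem_setOf_eq, not_forall] at hxf hxg
      obtain ⟨v1, hv1, h1⟩ := hxf
      obtain ⟨v2, hv2, h2'⟩ := hxg
      obtain ⟨u, hu, h3⟩ := line_mul x f g ⟨v1, hv1, h1⟩ ⟨v2, hv2, h2'⟩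
      exact h3 (hfg x hx u hu)

theorem irreducible_of_prime {S : Set (PP K ι)} (h0 : S.Nonempty) (h : (Ivan S).IsPrime) :
    IsZIrreducible S := by
  refine ⟨h0, fun Y Z hY hZ hS => ?_⟩
  by_contra hc
  rw [not_or, Set.not_subset, Set.not_subset] at hc
  obtain ⟨⟨x, hx, hxY⟩, ⟨z, hz, hzZ⟩⟩ := hc
  obtain ⟨f, hf, v, hv, h1⟩ := hY.sep hxY
  obtain ⟨g, hg, w, hw, h2⟩ := hZ.sep hzZ
  have : f * g ∈ Ivan S := by
    intro y hy u hu
    rcases hS hy with h | h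
    · simp [hf y h u hu]
    · simp [hg y h u hu]
  rcases h.mem_or_mem this with h | h
  · exact h1 (h x hx v hv)
  · exact h2 (h z hz w hw)

theorem IsZIrreducible.finite_union [Infinite K] {S : Set (PP K ι)} (hS : IsZIrreducible S)
    {α : Type*} [Finite α] (Y : α → Set (PP K ι)) (hY : ∀ a, IsZClosed (Y a))
    (h : S ⊆ ⋃ a, Y a) : ∃ a, S ⊆ Y a := by
  classical
  haveI := Fintype.ofFinite α
  by_contra hc
  push Not at hc
  have hc' : ∀ a, ∃ f ∈ Ivan (Y a), f ∉ Ivan S := by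
    intro a
    obtain ⟨x, hx, hxa⟩ := Set.not_subset.1 (hc a)
    obtain ⟨f, hf, v, hv, h1⟩ := (hY a).sep hxa
    exact ⟨f, hf, fun h => h1 (h x hx v hv)⟩
  choose f hf hfS using hc'
  have : ∏ a, f a ∈ Ivan S := by
    intro x hx v hv
    obtain ⟨a, ha⟩ := Set.mem_iUnion.1 (h hx)
    rw [map_prod]
    exact Finset.prod_eq_zero (Finset.mem_univ a) (hf a x ha v hv)
  rw [hS.prime.prod_mem_iff] at this
  obtain ⟨a, -, ha⟩ := this
  exact hfS a ha

theorem isZClosed_iUnion [Infinite K] {α : Type*} [Finite α] (Y : α → Set (PP K ι))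
    (hY : ∀ a, IsZClosed (Y a)) : IsZClosed (⋃ a, Y a) := by
  classical
  haveI := Fintype.ofFinite α
  have : ∀ s : Finset α, IsZClosed (⋃ a ∈ s, Y a) := by
    intro s
    induction s using Finset.induction_on with
    | empty => simpa using isZClosed_empty
    | insert a s ha ih =>
      rw [Finset.set_biUnion_insert]; exact isZClosed_union (hY a) ih
  simpa using this Finset.univ

theorem IsZIrreducible.closure [Infinite K] {S : Set (PP K ι)} (hS : IsZIrreducible S) :
    IsZIrreducible (zclosure S) :=
  irreducible_of_prime (hS.1.mono (subset_zclosure S)) (by rw [Ivan_zclosure]; exact hS.prime)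

theorem irreducible_singleton (x : PP K ι) : IsZIrreducible ({x} : Set (PP K ι)) :=
  ⟨⟨x, rfl⟩, fun Y Z _ _ h => by simpa using h⟩

theorem exists_component {S D : Set (PP K ι)} (hD : IsZIrreducible D) (hDS : D ⊆ S) :
    ∃ C, IsZIrredComponent S C ∧ D ⊆ C := by
  obtain ⟨C, hDC, hC⟩ := zorn_subset_nonempty {C | IsZIrreducible C ∧ C ⊆ S} (by
    intro c hc hchain hne
    refine ⟨⋃₀ c, ⟨⟨?_, ?_⟩, Set.sUnion_subset fun s hs => (hc hs).2⟩,
      fun s hs => Set.subset_sUnion_of_mem hs⟩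
    · obtain ⟨s, hs⟩ := hne
      exact (hc hs).1.1.mono (Set.subset_sUnion_of_mem hs)
    · intro Y Z hY hZ h
      by_contra hcon
      rw [not_or, Set.sUnion_subset_iff, Set.sUnion_subset_iff] at hcon
      push Not at hcon
      obtain ⟨⟨s, hs, hsY⟩, ⟨t, ht, htZ⟩⟩ := hcon
      rcases hchain.total hs ht with hst | hst
      · rcases (hc ht).1.2 Y Z hY hZ ((Set.subset_sUnion_of_mem ht).trans h) with h | h
        · exact hsY (hst.trans h)
        · exact htZ h
      · rcases (hc hs).1.2 Y Z hY hZ ((Set.subset_sUnion_of_mem hs).trans h) with h | h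
        · exact hsY h
        · exact htZ (hst.trans h)) D ⟨hD, hDS⟩
  refine ⟨C, ⟨hC.prop.1, hC.prop.2, fun E hE hES hCE => ?_⟩, hDC⟩
  exact hC.eq_of_subset ⟨hE, hES⟩ hCE

theorem exists_derivation {K L : Type*} [Field K] [CharZero K] [Field L] [Algebra K L]
    {τ : Type*} (x : τ → L) (hx : AlgebraicIndependent K x) (j : τ) [DecidableEq τ] :
    ∃ D : Derivation K L L, ∀ l, D (x l) = if l = j then 1 else 0 := by
  classical
  obtain ⟨t, hst, ht⟩ := exists_isTranscendenceBasis_superset (R := K) hx.coe_range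
  let A := MvPolynomial t K
  letI : Algebra A L := (MvPolynomial.aeval (R := K) (fun i : t => (i : L))).toRingHom.toAlgebra
  haveI : IsScalarTower K A L := IsScalarTower.of_algebraMap_eq fun r => by
    change _ = MvPolynomial.aeval (fun i : t => (i : L)) (algebraMap K A r)
    rw [AlgHom.commutes]
  have hinj : Function.Injective (algebraMap A L) := ht.1
  haveI : FaithfulSMul A L := (faithfulSMul_iff_algebraMap_injective A L).2 hinj
  letI : Algebra (FractionRing A) L := FractionRing.liftAlgebra A L
  haveI : IsScalarTower A (FractionRing A) L := FractionRing.isScalarTower_liftAlgebra A L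
  haveI halg : Algebra.IsAlgebraic A L := by
    have := ht.isAlgebraic
    refine Algebra.IsAlgebraic.of_ringHom_of_comp_eq (ht.1.aevalEquiv.toRingHom) (RingHom.id L) 
      ht.1.aevalEquiv.surjective Function.injective_id ?_
    ext r
    · change ((ht.1.aevalEquiv (MvPolynomial.C r) : Algebra.adjoin K (Set.range fun i : t => (i : L))) : L) = MvPolynomial.aeval (fun i : t => (i : L)) (MvPolynomial.C r)
      simp
    · change ((ht.1.aevalEquiv (MvPolynomial.X r) : Algebra.adjoin K (Set.range fun i : t => (i : L))) : L) = MvPolynomial.aeval (fun i : t => (i : L)) (MvPolynomial.X r)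
      simp
  haveI : Algebra.IsAlgebraic (FractionRing A) L := (IsFractionRing.comap_isAlgebraic_iff (A := A) (K := FractionRing A) (C := L)).1 halg
  haveI : CharZero (FractionRing A) := charZero_of_injective_algebraMap (FaithfulSMul.algebraMap_injective K (FractionRing A))
  haveI : Algebra.FormallyEtale (FractionRing A) L := Algebra.FormallyEtale.of_isSeparable _ _
  haveI : Algebra.FormallyEtale A (FractionRing A) := Algebra.FormallyEtale.of_isLocalization (nonZeroDivisors A)
  haveI : Algebra.FormallyEtale A L := Algebra.FormallyEtale.comp A (FractionRing A) L
  let d0 : Derivation K A L := MvPolynomial.mkDerivation K (fun i : t => if (i : L) = x j then 1 else 0)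
  let l0 : TensorProduct A L (Ω[A⁄K]) →ₗ[L] L := 
    d0.liftKaehlerDifferential.liftBaseChange L
  let D : Derivation K L L := 
    (l0 ∘ₗ (KaehlerDifferential.tensorKaehlerEquivOfFormallyEtale K A L).symm.toLinearMap).compDer
      (KaehlerDifferential.D K L)
  refine ⟨D, fun l => ?_⟩
  have hl : x l ∈ t := hst ⟨l, rfl⟩
  have h1 : x l = algebraMap A L (MvPolynomial.X ⟨x l, hl⟩) := by
    change _ = MvPolynomial.aeval (fun i : t => (i : L)) (MvPolynomial.X ⟨x l, hl⟩)
    simp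
  have h2 : D (algebraMap A L (MvPolynomial.X ⟨x l, hl⟩)) = if x l = x j then 1 else 0 := by
    change l0 ((KaehlerDifferential.tensorKaehlerEquivOfFormallyEtale K A L).symm 
      (KaehlerDifferential.D K L (algebraMap A L (MvPolynomial.X ⟨x l, hl⟩)))) = _
    rw [KaehlerDifferential.tensorKaehlerEquivOfFormallyEtale_symm_D_algebraMap]
    change d0.liftKaehlerDifferential.liftBaseChange L _ = _
    rw [LinearMap.liftBaseChange_tmul, Derivation.liftKaehlerDifferential_comp_D, one_smul]
    change MvPolynomial.mkDerivation K _ _ = _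
    rw [MvPolynomial.mkDerivation_X]
  conv_lhs => rw [h1]
  rw [h2]
  simp [hx.injective.eq_iff]

theorem ai_step {K A : Type*} [Field K] [CommRing A] [Algebra K A] (Q Q' : Ideal A)
    (hQ : Q.IsPrime) (hlt : Q < Q') {s : ℕ} (ψ : Fin s → A)
    (hψ : ∀ F : MvPolynomial (Fin s) K, MvPolynomial.aeval ψ F ∈ Q' → F = 0) :
    ∃ ψ' : Fin (s + 1) → A, ∀ F : MvPolynomial (Fin (s + 1)) K,
      MvPolynomial.aeval ψ' F ∈ Q → F = 0 := by
  obtain ⟨hle, z, hz, hzQ⟩ := SetLike.lt_iff_le_and_exists.1 hlt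
  let π : A →ₐ[K] (A ⧸ Q) := Ideal.Quotient.mkₐ K Q
  have hπ : ∀ {n : ℕ} (ψ : Fin n → A) (F : MvPolynomial (Fin n) K),
      MvPolynomial.aeval (fun i => π (ψ i)) F = 0 ↔ MvPolynomial.aeval ψ F ∈ Q := by
    intro n ψ F
    have : MvPolynomial.aeval (fun i => π (ψ i)) F = π (MvPolynomial.aeval ψ F) := by
      rw [← AlgHom.comp_apply, MvPolynomial.comp_aeval]
    rw [this]
    exact Ideal.Quotient.eq_zero_iff_mem
  have h1 : AlgebraicIndependent K (fun i => π (ψ i)) := by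
    rw [algebraicIndependent_iff]
    intro F hF
    exact hψ F (hle ((hπ ψ F).1 hF))
  have h2 : Transcendental (Algebra.adjoin K (Set.range fun i => π (ψ i))) (π z) := by
    intro halg
    have hz0 : π z ≠ 0 := fun h => hzQ (Ideal.Quotient.eq_zero_iff_mem.1 h)
    obtain ⟨q, hq0, hq⟩ := halg.exists_nonzero_coeff_and_aeval_eq_zero
      (mem_nonZeroDivisors_of_ne_zero hz0)
    rw [← Polynomial.divX_mul_X_add q] at hq
    rw [map_add, map_mul, Polynomial.aeval_X, Polynomial.aeval_C] at hq
    obtain ⟨F, hF⟩ : ∃ F, MvPolynomial.aeval (R := K) (fun i => π (ψ i)) F = (q.coeff 0 : A ⧸ Q) := by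
      exact (Algebra.adjoin_range_eq_range_aeval K (fun i => π (ψ i))).le (q.coeff 0).2
    obtain ⟨w, hw⟩ := Ideal.Quotient.mkₐ_surjective K Q ((Polynomial.aeval (π z)) q.divX)
    have h3 : π (w * z + MvPolynomial.aeval ψ F) = 0 := by
      rw [map_add, map_mul, ← AlgHom.comp_apply, MvPolynomial.comp_aeval]
      rw [← hq, ← hw]
      congr 1
    have h4 : MvPolynomial.aeval ψ F ∈ Q' := by
      have := hle (Ideal.Quotient.eq_zero_iff_mem.1 h3)
      exact (Ideal.add_mem_iff_right _ (Ideal.mul_mem_left _ _ hz)).1 this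
    have := hψ F h4
    apply hq0
    apply Subtype.ext
    rw [← hF, this]; simp
  have h3 := AlgebraicIndependent.option_iff.2 ⟨h1, h2⟩
  have h4 := h3.comp (finSuccEquiv s) (finSuccEquiv s).injective
  refine ⟨Fin.cons z ψ, fun F hF => ?_⟩
  rw [algebraicIndependent_iff] at h4
  have hfun : ((fun o => o.elim (π z) fun i => π (ψ i)) ∘ finSuccEquiv s) =
      fun i => π ((Fin.cons z ψ : Fin (s+1) → A) i) := by
    funext i
    refine Fin.cases ?_ (fun i => ?_) i
    · simp
    · simp
  rw [hfun] at h4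
  exact h4 F ((hπ _ F).2 hF)


theorem PV_nonempty {W : Submodule K (ι → K)} (hW : W ≠ ⊥) : (PV W).Nonempty := by
  obtain ⟨v, hv, h0⟩ := (Submodule.ne_bot_iff W).1 hW
  refine ⟨Projectivization.mk K v h0, ?_⟩
  rw [PV, Set.mem_setOf_eq, Projectivization.submodule_mk, Submodule.span_singleton_le_iff_mem]
  exact hv

theorem mem_Ivan_PV {W : Submodule K (ι → K)} (hW : W ≠ ⊥) (f : MvPolynomial ι K) :
    f ∈ Ivan (PV W) ↔ ∀ v ∈ W, MvPolynomial.eval v f = 0 := by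
  constructor
  · intro h v hv
    by_cases h0 : v = 0
    · obtain ⟨x, hx⟩ := PV_nonempty hW
      exact h x hx v (h0 ▸ Submodule.zero_mem _)
    · refine h (Projectivization.mk K v h0) ?_ v ?_
      · rw [PV, Set.mem_setOf_eq, Projectivization.submodule_mk, Submodule.span_singleton_le_iff_mem]
        exact hv
      · rw [Projectivization.submodule_mk]; exact Submodule.mem_span_singleton_self _
  · intro h x hx v hv
    exact h v (hx hv)

/-- restriction to a linear subspace -/
def resHom {d : ℕ} (b : Fin d → (ι → K)) : MvPolynomial ι K →ₐ[K] MvPolynomial (Fin d) K :=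
  MvPolynomial.aeval (fun i => ∑ j, MvPolynomial.C (b j i) * MvPolynomial.X j)

theorem eval_resHom {d : ℕ} (b : Fin d → (ι → K)) (f : MvPolynomial ι K) (z : Fin d → K) :
    MvPolynomial.eval z (resHom b f) = MvPolynomial.eval (∑ j, z j • b j) f := by
  rw [resHom, MvPolynomial.aeval_def, MvPolynomial.eval_eval₂]
  have : MvPolynomial.eval (∑ j, z j • b j) f = MvPolynomial.eval₂ (RingHom.id K) (∑ j, z j • b j) f := rfl
  rw [this]
  congr 1
  · ext; simp
  · ext i; simp [Finset.sum_apply, mul_comm]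

theorem resHom_eq_zero [Infinite K] {W : Submodule K (ι → K)} (hW : W ≠ ⊥) {d : ℕ}
    (b : Module.Basis (Fin d) K W) (f : MvPolynomial ι K) :
    resHom (fun j => (b j : ι → K)) f = 0 ↔ f ∈ Ivan (PV W) := by
  rw [mem_Ivan_PV hW]
  constructor
  · intro h v hv
    have := eval_resHom (fun j => (b j : ι → K)) f (b.repr ⟨v, hv⟩)
    rw [h, map_zero] at this
    have h2 := congrArg Subtype.val (b.sum_repr ⟨v, hv⟩)
    simp only [Submodule.coe_sum, Submodule.coe_smul] at h2
    rw [← h2]; exact this.symm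
  · intro h
    apply MvPolynomial.funext
    intro z
    rw [eval_resHom, map_zero]
    exact h _ (Submodule.sum_mem _ fun j _ => Submodule.smul_mem _ _ (b j).2)

theorem irreducible_PV [Infinite K] {W : Submodule K (ι → K)} (hW : W ≠ ⊥) :
    IsZIrreducible (PV W) := by
  refine irreducible_of_prime (PV_nonempty hW) ?_
  have : Ivan (PV W) = RingHom.ker (resHom (fun j => (Module.finBasis K W j : ι → K))) := by
    ext f; rw [RingHom.mem_ker, resHom_eq_zero hW]
  rw [this]
  exact RingHom.ker_isPrime _

/-- linear polynomial of a functional -/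
def linPoly (c : ι → K) : MvPolynomial ι K := ∑ i, MvPolynomial.C (c i) * MvPolynomial.X i

theorem eval_linPoly (c v : ι → K) : MvPolynomial.eval v (linPoly c) = ∑ i, c i * v i := by
  simp [linPoly]

theorem exists_sep {W : Submodule K (ι → K)} {v : ι → K} (hv : v ∉ W) :
    ∃ c : ι → K, (∀ w ∈ W, ∑ i, c i * w i = 0) ∧ ∑ i, c i * v i ≠ 0 := by
  classical
  obtain ⟨f, hf, hW⟩ := Submodule.exists_le_ker_of_notMem hv
  have key : ∀ w : ι → K, f w = ∑ i, f (Pi.single i 1) * w i := by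
    intro w
    conv_lhs => rw [pi_eq_sum_univ' w]
    rw [map_sum]
    refine Finset.sum_congr rfl fun i _ => ?_
    rw [map_smul, smul_eq_mul, mul_comm]
  refine ⟨fun i => f (Pi.single i 1), fun w hw => ?_, ?_⟩
  · rw [← key]; exact hW hw
  · rw [← key]; exact hf

theorem isZClosed_PV [Infinite K] (W : Submodule K (ι → K)) : IsZClosed (PV W) := by
  have : PV W = zeroLocus {f | ∃ c : ι → K, (∀ w ∈ W, ∑ i, c i * w i = 0) ∧ f = linPoly c} := by
    ext x
    constructor
    · rintro hx f ⟨c, hc, rfl⟩ v hv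
      rw [eval_linPoly]; exact hc v (hx hv)
    · intro hx
      by_contra hn
      rw [mem_PV] at hn
      obtain ⟨c, hc, h⟩ := exists_sep hn
      apply h
      rw [← eval_linPoly]
      exact hx _ ⟨c, hc, rfl⟩ _ (rep_mem x)
  rw [this]
  exact isZClosed_zeroLocus _

theorem Ivan_lt {Y Z : Set (PP K ι)} (hY : IsZClosed Y) (hZ : IsZClosed Z) (h : Y < Z) :
    Ivan Z < Ivan Y := by
  refine lt_of_le_of_ne (Ivan_anti h.le) fun he => h.ne ?_
  rw [hY.eq_zeroLocus, hZ.eq_zeroLocus, he]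

theorem ZD [Infinite K] {B : Type*} [CommRing B] [Algebra K B] (φ : MvPolynomial ι K →ₐ[K] B)
    (S : Set (PP K ι)) (hker : ∀ f, φ f = 0 → f ∈ Ivan S) (d : ℕ)
    (hd : ((d : ℕ∞) : WithBot ℕ∞) ≤ zdim S) :
    ∃ ψ : Fin (d + 1) → MvPolynomial ι K, AlgebraicIndependent K (fun i => φ (ψ i)) := by
  obtain ⟨l, hl⟩ := Order.le_krullDim_iff.1 hd
  have main : ∀ i : ℕ, ∀ hi : i < l.length + 1, ∃ ψ : Fin (i + 1) → MvPolynomial ι K,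
      ∀ F : MvPolynomial (Fin (i + 1)) K,
        MvPolynomial.aeval ψ F ∈ Ivan (l ⟨i, hi⟩).1 → F = 0 := by
    intro i
    induction i with
    | zero =>
      intro hi
      refine ai_step (Ivan (l ⟨0, hi⟩).1) (RingHom.ker (MvPolynomial.eval (0 : ι → K)))
        (l ⟨0, hi⟩).2.2.1.prime ?_ (Fin.elim0) ?_
      · obtain ⟨x, hx⟩ := (l ⟨0, hi⟩).2.2.1.1
        refine SetLike.lt_iff_le_and_exists.2 ⟨fun f hf => hf x hx 0 (Submodule.zero_mem _), ?_⟩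
        obtain ⟨i, hi⟩ := Function.ne_iff.1 x.rep_nonzero
        refine ⟨MvPolynomial.X i, by simp, fun h => hi ?_⟩
        simpa using h x hx _ (rep_mem x)
      · intro F hF
        rw [MvPolynomial.eq_C_of_isEmpty F] at hF ⊢
        simp only [MvPolynomial.algHom_C, RingHom.mem_ker, MvPolynomial.algebraMap_eq,
          MvPolynomial.eval_C] at hF
        rw [hF, map_zero]
    | succ i ih =>
      intro hi
      obtain ⟨ψ, hψ⟩ := ih (by omega)
      refine ai_step (Ivan (l ⟨i + 1, hi⟩).1) (Ivan (l ⟨i, by omega⟩).1)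
        (l ⟨i + 1, hi⟩).2.2.1.prime ?_ ψ hψ
      have : l ⟨i, by omega⟩ < l ⟨i+1, hi⟩ := l.strictMono (by simp [Fin.lt_def])
      exact Ivan_lt (l ⟨i, by omega⟩).2.1 (l ⟨i + 1, hi⟩).2.1 this
  subst hl
  obtain ⟨ψ, hψ⟩ := main l.length (by omega)
  refine ⟨ψ, ?_⟩
  rw [algebraicIndependent_iff]
  intro F hF
  apply hψ
  have h1 : MvPolynomial.aeval (fun i => φ (ψ i)) F = φ (MvPolynomial.aeval ψ F) := by
    rw [← AlgHom.comp_apply, MvPolynomial.comp_aeval]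
  rw [h1] at hF
  have := hker _ hF
  rw [← Ivan_zclosure] at this
  exact Ivan_anti (l _).2.2.2 this

theorem zdim_PV_le [Infinite K] {W : Submodule K (ι → K)} (hW : W ≠ ⊥) (d : ℕ)
    (hd : ((d : ℕ∞) : WithBot ℕ∞) ≤ zdim (PV W)) : d + 1 ≤ Module.finrank K W := by
  obtain ⟨ψ, hψ⟩ := ZD (resHom (fun j => (Module.finBasis K W j : ι → K))) (PV W)
    (fun f hf => (resHom_eq_zero hW _ f).1 hf) d hd
  have h1 := hψ.lift_cardinalMk_le_trdeg
  rw [MvPolynomial.trdeg_of_isDomain] at h1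
  simpa using h1

theorem le_zdim_PV [Infinite K] {W : Submodule K (ι → K)} (d : ℕ)
    (hd : d + 1 = Module.finrank K W) : ((d : ℕ∞) : WithBot ℕ∞) ≤ zdim (PV W) := by
  let b := (Module.finBasisOfFinrankEq K W hd.symm)
  let bb : Fin (d + 1) → (ι → K) := fun j => (b j : ι → K)
  have hli : LinearIndependent K bb := b.linearIndependent.map' W.subtype (by simp)
  let U : Fin (d+1) → Submodule K (ι → K) := fun j => Submodule.span K (bb '' Set.Iic j)
  have hU : ∀ j, bb j ∈ U j := fun j => Submodule.subset_span ⟨j, Set.mem_Iic.2 le_rfl, rfl⟩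
  have hmono : StrictMono U := by
    intro i j hij
    refine SetLike.lt_iff_le_and_exists.2 ⟨Submodule.span_mono (Set.image_mono (Set.Iic_subset_Iic.2 hij.le)), bb j, hU j, ?_⟩
    exact hli.notMem_span_image (by simpa using hij)
  have hb : ∀ j, U j ≠ ⊥ := fun j h => hli.ne_zero j (by
    have := hU j
    rw [h] at this
    simpa using this)
  apply Order.le_krullDim_iff.2
  refine ⟨LTSeries.mk d (fun j => ⟨PV (U j), isZClosed_PV _, irreducible_PV (hb j), ?_⟩) ?_, rfl⟩
  · refine Set.Subset.trans (PV_mono ?_) (subset_zclosure _)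
    rw [Submodule.span_le]
    rintro _ ⟨i, -, rfl⟩
    exact (b i).2
  · intro i j hij
    have := hmono hij
    exact ⟨PV_mono this.le, fun h => this.not_ge (PV_subset_iff.1 h)⟩

theorem zdim_PV_iff [Infinite K] {W : Submodule K (ι → K)} (n : ℕ) :
    zdim (PV W) = ((n : ℕ∞) : WithBot ℕ∞) ↔ Module.finrank K W = n + 1 := by
  by_cases hW : W = ⊥
  · subst hW
    have : PV (⊥ : Submodule K (ι → K)) = ∅ := by
      rw [Set.eq_empty_iff_forall_notMem]
      intro x hx
      rw [mem_PV] at hx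
      exact x.rep_nonzero (by simpa using hx)
    rw [this]
    simp only [finrank_bot]
    constructor
    · intro h
      exfalso
      have h0 : zdim (∅ : Set (PP K ι)) = ⊥ := by
        rw [zdim, zclosure_eq isZClosed_empty, Order.krullDim_eq_bot_iff]
        refine ⟨fun Y => ?_⟩
        obtain ⟨x, hx⟩ := Y.2.2.1.1
        exact Y.2.2.2 hx
      rw [h0] at h
      exact WithBot.bot_ne_coe h
    · intro h; omega
  · constructor
    · intro h
      have h1 := zdim_PV_le hW n h.ge
      obtain ⟨d, hd⟩ : ∃ d, d + 1 = Module.finrank K W := ⟨Module.finrank K W - 1, by omega⟩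
      have h2 := le_zdim_PV d hd
      rw [h] at h2
      have : d ≤ n := by exact_mod_cast h2
      omega
    · intro h
      refine le_antisymm ?_ (le_zdim_PV n h.symm)
      by_contra hc
      rw [not_le] at hc
      have : ((n + 1 : ℕ) : ℕ∞) ≤ zdim (PV W) := by
        revert hc
        generalize zdim (PV W) = z
        intro hc
        cases z with
        | bot => exact absurd hc (by simp)
        | coe z =>
          have h3 : (n : ℕ∞) < z := by exact_mod_cast hc
          have h4 := Order.add_one_le_of_lt h3
          exact_mod_cast h4
      have := zdim_PV_le hW (n+1) this
      omega


theorem mem_coneOf {X : Set (PP K ι)} {v : ι → K} :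
    v ∈ coneOf X ↔ ∃ x ∈ X, v ∈ x.submodule := by
  simp [coneOf]

theorem mk_mem_of_cone {X : Set (PP K ι)} {v : ι → K} (hv : v ∈ coneOf X) (h0 : v ≠ 0) :
    Projectivization.mk K v h0 ∈ X := by
  obtain ⟨x, hx, hvx⟩ := mem_coneOf.1 hv
  rw [mk_of_mem hvx h0]; exact hx

theorem mem_mk_submodule {v : ι → K} (h0 : v ≠ 0) : v ∈ (Projectivization.mk K v h0).submodule := by
  rw [Projectivization.submodule_mk]; exact Submodule.mem_span_singleton_self _

/-- evaluation at a tuple -/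
def evt {m : ℕ} (v : Fin m → ι → K) : MvPolynomial (Fin m × ι) K →+* K :=
  MvPolynomial.eval (fun p => v p.1 p.2)

theorem cone_prime [Infinite K] {X : Set (PP K ι)} (hX : IsZIrreducible X)
    (f g : MvPolynomial ι K) (hf : ∃ v ∈ coneOf X, MvPolynomial.eval v f ≠ 0)
    (hg : ∃ v ∈ coneOf X, MvPolynomial.eval v g ≠ 0) :
    ∃ v ∈ coneOf X, MvPolynomial.eval v f ≠ 0 ∧ MvPolynomial.eval v g ≠ 0 := by
  by_contra hc
  have : f * g ∈ Ivan X := by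
    intro x hx v hv
    by_contra h
    rw [map_mul] at h
    exact hc ⟨v, mem_coneOf.2 ⟨x, hx, hv⟩, left_ne_zero_of_mul h, right_ne_zero_of_mul h⟩
  rcases hX.prime.mem_or_mem this with h | h
  · obtain ⟨v, hv, h1⟩ := hf
    obtain ⟨x, hx, hvx⟩ := mem_coneOf.1 hv
    exact h1 (h x hx v hvx)
  · obtain ⟨v, hv, h1⟩ := hg
    obtain ⟨x, hx, hvx⟩ := mem_coneOf.1 hv
    exact h1 (h x hx v hvx)

/-- partial evaluation -/
def partEval {m : ℕ} (v : Fin m → ι → K) (a : Fin m) (g : MvPolynomial (Fin m × ι) K) :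
    MvPolynomial ι K :=
  MvPolynomial.aeval (fun p => if p.1 = a then MvPolynomial.X p.2 else MvPolynomial.C (v p.1 p.2)) g

theorem eval_partEval {m : ℕ} (v : Fin m → ι → K) (a : Fin m) (g : MvPolynomial (Fin m × ι) K)
    (x : ι → K) : MvPolynomial.eval x (partEval v a g) = evt (Function.update v a x) g := by
  rw [partEval, MvPolynomial.aeval_def, MvPolynomial.eval_eval₂, evt]
  refine Eq.trans ?_ (MvPolynomial.eval₂_id _).symm.symm
  rw [MvPolynomial.eval, MvPolynomial.coe_eval₂Hom]
  congr 1
  · ext; simp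
  · ext ⟨p, i⟩
    by_cases h : p = a
    · subst h; simp
    · simp [h]

theorem tuple_prime [Infinite K] {X : Set (PP K ι)} (hX : IsZIrreducible X) {m : ℕ}
    (f g : MvPolynomial (Fin m × ι) K)
    (hf : ∃ v : Fin m → ι → K, (∀ p, v p ∈ coneOf X) ∧ evt v f ≠ 0)
    (hg : ∃ v : Fin m → ι → K, (∀ p, v p ∈ coneOf X) ∧ evt v g ≠ 0) :
    ∃ v : Fin m → ι → K, (∀ p, v p ∈ coneOf X) ∧ evt v f ≠ 0 ∧ evt v g ≠ 0 := by
  classical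
  have main : ∀ s : Finset (Fin m), ∀ v w : Fin m → ι → K, (∀ p, v p ∈ coneOf X) →
      (∀ p, w p ∈ coneOf X) → evt v f ≠ 0 → evt w g ≠ 0 → (∀ p ∉ s, v p = w p) →
      ∃ v : Fin m → ι → K, (∀ p, v p ∈ coneOf X) ∧ evt v f ≠ 0 ∧ evt v g ≠ 0 := by
    intro s
    induction s using Finset.induction_on with
    | empty =>
      intro v w hv hw h1 h2 h
      have : v = w := funext fun p => h p (by simp)
      subst this
      exact ⟨v, hv, h1, h2⟩
    | insert a s ha ih =>
      intro v w hv hw h1 h2 h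
      obtain ⟨x, hx, hx1, hx2⟩ := cone_prime hX (partEval v a f) (partEval w a g)
        ⟨v a, hv a, by rw [eval_partEval, Function.update_eq_self]; exact h1⟩
        ⟨w a, hw a, by rw [eval_partEval, Function.update_eq_self]; exact h2⟩
      rw [eval_partEval] at hx1 hx2
      refine ih _ _ ?_ ?_ hx1 hx2 ?_
      · intro p
        by_cases hp : p = a
        · subst hp; simpa using hx
        · simpa [hp] using hv p
      · intro p
        by_cases hp : p = a
        · subst hp; simpa using hx
        · simpa [hp] using hw p
      · intro p hp
        by_cases hpa : p = a
        · subst hpa; simp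
        · simpa [hpa] using h p (by simp [hp, hpa])
  obtain ⟨v, hv, h1⟩ := hf
  obtain ⟨w, hw, h2⟩ := hg
  exact main Finset.univ v w hv hw h1 h2 (by simp)

/-- genericity reformulated -/
def Gen (X : Set (PP K ι)) (m : ℕ) (P : (Fin m → PP K ι) → Prop) : Prop :=
  ∃ g : MvPolynomial (Fin m × ι) K,
    (∃ v : Fin m → ι → K, (∀ p, v p ∈ coneOf X) ∧ evt v g ≠ 0) ∧
    ∀ v : Fin m → ι → K, (∀ p, v p ∈ coneOf X) → ∀ hv : ∀ p, v p ≠ 0, evt v g ≠ 0 →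
      P (fun p => Projectivization.mk K (v p) (hv p))

theorem exists_nonzero_witness [Infinite K] {X : Set (PP K ι)} (hX : IsZIrreducible X) {m : ℕ} :
    ∃ h : MvPolynomial (Fin m × ι) K,
      (∃ v : Fin m → ι → K, (∀ p, v p ∈ coneOf X) ∧ evt v h ≠ 0) ∧
      ∀ v : Fin m → ι → K, evt v h ≠ 0 → ∀ p, v p ≠ 0 := by
  obtain ⟨x, hx⟩ := hX.1
  obtain ⟨i, hi⟩ := Function.ne_iff.1 x.rep_nonzero
  refine ⟨∏ p, MvPolynomial.X (p, i), ⟨fun _ => x.rep, fun _ => mem_coneOf.2 ⟨x, hx, rep_mem x⟩, ?_⟩, ?_⟩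
  · rw [evt, map_prod, Finset.prod_ne_zero_iff]
    intro p _
    simpa using hi
  · intro v h p h0
    rw [evt, map_prod, Finset.prod_ne_zero_iff] at h
    have := h p (Finset.mem_univ _)
    simp [h0] at this

theorem holds_iff_gen [Infinite K] {X : Set (PP K ι)} (hX : IsZIrreducible X) (m : ℕ)
    (P : (Fin m → PP K ι) → Prop) : HoldsForGeneralTuples X m P ↔ Gen X m P := by
  constructor
  · rintro ⟨T, ⟨S, -, rfl⟩, ⟨u, hu, huT⟩, h⟩
    simp only [multiZeroLocus, Set.mem_setOf_eq, not_forall] at huT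
    obtain ⟨f, hf, v, hv, hne⟩ := huT
    refine ⟨f, ⟨v, fun p => mem_coneOf.2 ⟨u p, hu p, hv p⟩, hne⟩, ?_⟩
    intro w hw hw0 hwne
    refine h _ (fun p => mk_mem_of_cone (hw p) _) fun hT => hwne ?_
    exact hT f hf w (fun p => mem_mk_submodule _)
  · rintro ⟨g, hg, h⟩
    obtain ⟨q, hq, hq2⟩ := exists_nonzero_witness hX (m := m)
    refine ⟨multiZeroLocus {g * q}, isMultiZClosed_multiZeroLocus _, ?_, ?_⟩
    · obtain ⟨v, hv, h1, h2⟩ := tuple_prime hX g q hg hq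
      refine ⟨fun p => Projectivization.mk K (v p) (hq2 v h2 p), fun p => mk_mem_of_cone (hv p) _, ?_⟩
      intro hT
      have := hT _ rfl v (fun p => mem_mk_submodule _)
      rw [map_mul] at this
      rcases mul_eq_zero.1 this with h' | h'
      · exact h1 h'
      · exact h2 h'
    · intro u hu huT
      simp only [multiZeroLocus, Set.mem_setOf_eq, not_forall, Set.mem_singleton_iff] at huT
      obtain ⟨f, rfl, v, hv, hne⟩ := huT
      rw [map_mul] at hne
      have h0 := hq2 v (right_ne_zero_of_mul hne)
      have := h v (fun p => mem_coneOf.2 ⟨u p, hu p, hv p⟩) h0 (left_ne_zero_of_mul hne)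
      convert this using 2 with p
      exact (mk_of_mem (hv p) _).symm

theorem Gen.mono {X : Set (PP K ι)} {m : ℕ} {P Q : (Fin m → PP K ι) → Prop} (h : Gen X m P)
    (hPQ : ∀ u, (∀ p, u p ∈ X) → P u → Q u) : Gen X m Q := by
  obtain ⟨g, hg, h⟩ := h
  exact ⟨g, hg, fun v hv h0 hne => hPQ _ (fun p => mk_mem_of_cone (hv p) _) (h v hv h0 hne)⟩

theorem Gen.and [Infinite K] {X : Set (PP K ι)} (hX : IsZIrreducible X) {m : ℕ}
    {P Q : (Fin m → PP K ι) → Prop} (h : Gen X m P) (h' : Gen X m Q) :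
    Gen X m (fun u => P u ∧ Q u) := by
  obtain ⟨g, hg, h⟩ := h
  obtain ⟨g', hg', h'⟩ := h'
  refine ⟨g * g', ?_, ?_⟩
  · obtain ⟨v, hv, h1, h2⟩ := tuple_prime hX g g' hg hg'
    exact ⟨v, hv, by rw [map_mul]; exact mul_ne_zero h1 h2⟩
  · intro v hv h0 hne
    rw [map_mul] at hne
    exact ⟨h v hv h0 (left_ne_zero_of_mul hne), h' v hv h0 (right_ne_zero_of_mul hne)⟩

theorem Gen.comap {X : Set (PP K ι)} {m m' : ℕ} {P : (Fin m → PP K ι) → Prop} (h : Gen X m P)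
    (hne : X.Nonempty) (e : Fin m → Fin m') (he : Function.Injective e) :
    Gen X m' (fun u => P (fun p => u (e p))) := by
  obtain ⟨g, ⟨v, hv, hg⟩, h⟩ := h
  have key : ∀ w : Fin m' → ι → K, evt w (MvPolynomial.rename (Prod.map e id) g) =
      evt (fun p => w (e p)) g := by
    intro w
    rw [evt, MvPolynomial.eval_rename]; rfl
  refine ⟨MvPolynomial.rename (Prod.map e id) g, ?_, ?_⟩
  · obtain ⟨x, hx⟩ := hne
    refine ⟨Function.extend e v (fun _ => x.rep), fun q => ?_, ?_⟩
    · by_cases hq : ∃ p, e p = q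
      · obtain ⟨p, rfl⟩ := hq
        rw [he.extend_apply]; exact hv p
      · rw [Function.extend_apply' _ _ _ hq]; exact mem_coneOf.2 ⟨x, hx, rep_mem x⟩
    · rw [key]
      simpa only [he.extend_apply] using hg
  · intro w hw h0 hne
    rw [key] at hne
    exact h _ (fun p => hw (e p)) (fun p => h0 (e p)) hne

theorem Gen.push [Infinite K] {X : Set (PP K ι)} (hX : IsZIrreducible X) {k l : ℕ}
    {P : (Fin (k + l) → PP K ι) → Prop} (h : Gen X (k + l) P) :
    Gen X k (fun u => ∃ w : Fin (k + l) → PP K ι, (∀ p, w p ∈ X) ∧ P w ∧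
      ∀ p, w (Fin.castAdd l p) = u p) := by
  obtain ⟨g, hg, h⟩ := h
  obtain ⟨q, hq, hq2⟩ := exists_nonzero_witness hX (m := k + l)
  obtain ⟨v, hv, h1, h2⟩ := tuple_prime hX g q hg hq
  have h0 := hq2 v h2
  let g' : MvPolynomial (Fin k × ι) K := MvPolynomial.aeval (fun p : Fin (k+l) × ι =>
    Fin.addCases (motive := fun _ => MvPolynomial (Fin k × ι) K)
      (fun a => MvPolynomial.X (a, p.2)) (fun b => MvPolynomial.C (v (Fin.natAdd k b) p.2)) p.1) g
  have key : ∀ w : Fin k → ι → K, evt w g' =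
      evt (Fin.append w (fun b => v (Fin.natAdd k b))) g := by
    intro w
    simp only [g', evt]
    rw [MvPolynomial.aeval_def, MvPolynomial.eval_eval₂]
    rw [MvPolynomial.eval, MvPolynomial.coe_eval₂Hom]
    conv_rhs => rw [MvPolynomial.eval, MvPolynomial.coe_eval₂Hom]
    congr 1
    · ext; simp
    · ext ⟨p, i⟩
      refine Fin.addCases (fun a => ?_) (fun b => ?_) p <;> simp
  refine ⟨g', ⟨fun a => v (Fin.castAdd l a), fun p => hv _, ?_⟩, ?_⟩
  · rw [key]
    convert h1 using 2
    congr 1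
    funext p
    refine Fin.addCases (fun a => ?_) (fun b => ?_) p <;> simp
  · intro w hw hw0 hne
    rw [key] at hne
    have hc : ∀ p, Fin.append w (fun b => v (Fin.natAdd k b)) p ∈ coneOf X := by
      intro p
      refine Fin.addCases (fun a => ?_) (fun b => ?_) p
      · simpa using hw a
      · simpa using hv _
    have hz : ∀ p, Fin.append w (fun b => v (Fin.natAdd k b)) p ≠ 0 := by
      intro p
      refine Fin.addCases (fun a => ?_) (fun b => ?_) p
      · simpa using hw0 a
      · simpa using h0 _
    refine ⟨_, fun p => mk_mem_of_cone (hc p) (hz p), h _ hc hz hne, fun p => ?_⟩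
    simp


/-- affine tangent space -/
def That (X : Set (PP K ι)) (v : ι → K) : Submodule K (ι → K) where
  carrier := {w | ∀ f ∈ homogVanishingIdeal X,
    ∑ i, w i * MvPolynomial.eval v (MvPolynomial.pderiv i f) = 0}
  add_mem' := by
    intro a b ha hb f hf
    simp only [Pi.add_apply, add_mul, Finset.sum_add_distrib, ha f hf, hb f hf, add_zero]
  zero_mem' := by intro f hf; simp
  smul_mem' := by
    intro c a ha f hf
    simp only [Pi.smul_apply, smul_eq_mul, mul_assoc, ← Finset.mul_sum, ha f hf, mul_zero]

theorem mem_That {X : Set (PP K ι)} {v w : ι → K} : w ∈ That X v ↔ ∀ f ∈ homogVanishingIdeal X,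
    ∑ i, w i * MvPolynomial.eval v (MvPolynomial.pderiv i f) = 0 := Iff.rfl

theorem eval_smul_homog {f : MvPolynomial ι K} {d : ℕ} (hf : f.IsHomogeneous d) (c : K)
    (v : ι → K) : MvPolynomial.eval (c • v) f = c ^ d * MvPolynomial.eval v f := by
  rw [MvPolynomial.eval_eq, MvPolynomial.eval_eq, Finset.mul_sum]
  refine Finset.sum_congr rfl fun s hs => ?_
  have h := hf (MvPolynomial.mem_support_iff.1 hs)
  rw [← h]
  simp only [Pi.smul_apply, smul_eq_mul, mul_pow, Finset.prod_mul_distrib, Finset.prod_pow_eq_pow_sum]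
  have : Finsupp.weight 1 s = ∑ i ∈ s.support, s i := by
    simp [Finsupp.weight_apply, Finsupp.sum]
  rw [this]; ring

theorem That_smul (X : Set (PP K ι)) (c : K) (hc : c ≠ 0) (v : ι → K) :
    That X (c • v) = That X v := by
  ext w
  rw [mem_That, mem_That]
  refine forall₂_congr fun f hf => ?_
  obtain ⟨⟨d, hd⟩, -⟩ := hf
  have : ∀ i, MvPolynomial.eval (c • v) (MvPolynomial.pderiv i f) =
      c ^ (d - 1) * MvPolynomial.eval v (MvPolynomial.pderiv i f) := fun i =>
    eval_smul_homog hd.pderiv c v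
  simp only [this]
  rw [← mul_right_inj' (pow_ne_zero (d - 1) hc) (b := ∑ i, w i * MvPolynomial.eval v (MvPolynomial.pderiv i f)), mul_zero, Finset.mul_sum]
  refine Eq.congr_left (Finset.sum_congr rfl fun i _ => by ring)

/-- tangent space at a projective point -/
def TT (X : Set (PP K ι)) (x : PP K ι) : Submodule K (ι → K) := That X x.rep

theorem TT_eq (X : Set (PP K ι)) {x : PP K ι} {v : ι → K} (hv : v ∈ x.submodule) (h0 : v ≠ 0) :
    TT X x = That X v := by
  have := mk_of_mem hv h0
  obtain ⟨a, ha⟩ := Projectivization.exists_smul_eq_mk_rep K v h0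
  rw [TT, ← this, ← ha]
  exact That_smul X a a.ne_zero v

/-- vanishing ideal of tuples -/
def PXm (X : Set (PP K ι)) (m : ℕ) : Ideal (MvPolynomial (Fin m × ι) K) where
  carrier := {f | ∀ v : Fin m → ι → K, (∀ p, v p ∈ coneOf X) → evt v f = 0}
  add_mem' := by
    intro a b ha hb v hv
    rw [map_add, ha v hv, hb v hv, add_zero]
  zero_mem' := by intro v hv; simp
  smul_mem' := by
    intro c f hf v hv
    rw [smul_eq_mul, map_mul, hf v hv, mul_zero]

theorem PXm_prime [Infinite K] {X : Set (PP K ι)} (hX : IsZIrreducible X) (m : ℕ) :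
    (PXm X m).IsPrime := by
  refine ⟨?_, ?_⟩
  · rw [Ideal.ne_top_iff_one]
    intro h
    obtain ⟨x, hx⟩ := hX.1
    have := h (fun _ => x.rep) (fun p => mem_coneOf.2 ⟨x, hx, rep_mem x⟩)
    simp at this
  · intro f g hfg
    by_contra hc
    rw [not_or] at hc
    obtain ⟨h1, h2⟩ := hc
    have h1' : ∃ v : Fin m → ι → K, (∀ p, v p ∈ coneOf X) ∧ evt v f ≠ 0 := by
      by_contra hh; push Not at hh; exact h1 hh
    have h2' : ∃ v : Fin m → ι → K, (∀ p, v p ∈ coneOf X) ∧ evt v g ≠ 0 := by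
      by_contra hh; push Not at hh; exact h2 hh
    obtain ⟨v, hv, a, b⟩ := tuple_prime hX f g h1' h2'
    have := hfg v hv
    rw [map_mul] at this
    exact (mul_ne_zero a b) this

/-- the sum map -/
def PhiM (m : ℕ) : MvPolynomial ι K →ₐ[K] MvPolynomial (Fin m × ι) K :=
  MvPolynomial.aeval (fun i => ∑ p, MvPolynomial.X (p, i))

theorem evt_PhiM {m : ℕ} (v : Fin m → ι → K) (f : MvPolynomial ι K) :
    evt v (PhiM m f) = MvPolynomial.eval (∑ p, v p) f := by
  rw [PhiM, evt, MvPolynomial.aeval_def, MvPolynomial.eval_eval₂]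
  conv_rhs => rw [MvPolynomial.eval, MvPolynomial.coe_eval₂Hom]
  congr 1
  · ext; simp
  · ext i; simp [Finset.sum_apply]

theorem pderiv_PhiM {m : ℕ} (c : Fin m × ι) (f : MvPolynomial ι K) :
    MvPolynomial.pderiv c (PhiM m f) = PhiM m (MvPolynomial.pderiv c.2 f) := by
  classical
  induction f using MvPolynomial.induction_on with
  | C a => 
    have : PhiM (K := K) (ι := ι) m (MvPolynomial.C a) = MvPolynomial.C a := by
      simp [PhiM, MvPolynomial.algebraMap_eq]
    simp [this]
  | add p q hp hq => simp [hp, hq]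
  | mul_X p i hp =>
    have h1 : PhiM (K := K) m (MvPolynomial.X i) = ∑ q, MvPolynomial.X (q, i) := by simp [PhiM]
    have h2 : MvPolynomial.pderiv c (PhiM (K := K) m (MvPolynomial.X i)) =
        PhiM m (MvPolynomial.pderiv c.2 (MvPolynomial.X i)) := by
      rw [h1, map_sum]
      simp only [MvPolynomial.pderiv_X]
      obtain ⟨q, j⟩ := c
      by_cases hij : i = j
      · subst hij
        simp [Pi.single_apply, Prod.ext_iff]
      · simp [Pi.single_apply, Prod.ext_iff, hij]
    rw [map_mul, Derivation.leibniz, Derivation.leibniz, hp, h2]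
    simp [smul_eq_mul]

theorem deriv_chain {L τ : Type*} [Field L] [Algebra K L] [Fintype τ]
    (ev : MvPolynomial τ K →ₐ[K] L) (D : Derivation K L L) (r : MvPolynomial τ K) :
    D (ev r) = ∑ c, ev (MvPolynomial.pderiv c r) * D (ev (MvPolynomial.X c)) := by
  classical
  induction r using MvPolynomial.induction_on with
  | C a =>
    have : ev (MvPolynomial.C a) = algebraMap K L a := ev.commutes a
    simp [this]
  | add p q hp hq => simp [hp, hq, add_mul, Finset.sum_add_distrib]
  | mul_X p i hp =>
    have h1 : ∀ c, ev (MvPolynomial.pderiv c (p * MvPolynomial.X i)) * D (ev (MvPolynomial.X c)) =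
        (if c = i then ev p * D (ev (MvPolynomial.X i)) else 0) + ev (MvPolynomial.X i) *
          (ev (MvPolynomial.pderiv c p) * D (ev (MvPolynomial.X c))) := by
      intro c
      rw [Derivation.leibniz, MvPolynomial.pderiv_X]
      by_cases h : c = i
      · subst h; simp [smul_eq_mul]; ring
      · simp [h, smul_eq_mul, Ne.symm h]; ring
    simp only [h1]
    rw [map_mul, Derivation.leibniz, hp, Finset.sum_add_distrib, ← Finset.mul_sum]
    simp [smul_eq_mul]

theorem mem_secant_cone {X : Set (PP K ι)} {m : ℕ} {S : Finset (PP K ι)} (hS : ↑S ⊆ X)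
    (hc : S.card = m) {v : ι → K} (hv : v ∈ vspan (S : Set (PP K ι))) :
    ∃ w : Fin m → ι → K, (∀ p, w p ∈ coneOf X) ∧ v = ∑ p, w p := by
  classical
  have hv' : v ∈ ⨆ x ∈ S, x.submodule := by
    refine (vspan_le_iff (S : Set (PP K ι)) (⨆ x ∈ S, x.submodule)).2 ?_ hv
    intro x hx
    exact le_iSup₂_of_le (f := fun (x : PP K ι) (_ : x ∈ S) => x.submodule) x hx le_rfl
  rw [Submodule.mem_iSup_finset_iff_exists_sum] at hv'
  obtain ⟨μ, hμ⟩ := hv'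
  let e := S.equivFinOfCardEq hc
  refine ⟨fun p => μ (e.symm p), fun p => mem_coneOf.2 ⟨_, hS (e.symm p).2, (μ _).2⟩, ?_⟩
  rw [← hμ, ← Finset.sum_coe_sort]
  exact (Equiv.sum_comp e.symm (fun x : S => (μ x : ι → K))).symm

theorem terracini [CharZero K] {X : Set (PP K ι)} (hX : IsZIrreducible X) (m d : ℕ)
    (hd : ((d : ℕ∞) : WithBot ℕ∞) ≤ zdim (secant m X)) :
    ∃ g : MvPolynomial (Fin m × ι) K,
      (∃ v : Fin m → ι → K, (∀ p, v p ∈ coneOf X) ∧ evt v g ≠ 0) ∧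
      ∀ v : Fin m → ι → K, (∀ p, v p ∈ coneOf X) → evt v g ≠ 0 →
        d + 1 ≤ Module.finrank K (⨆ p, That X (v p) : Submodule K (ι → K)) := by
  classical
  haveI : Infinite K := CharZero.infinite K
  haveI hp : (PXm X m).IsPrime := PXm_prime hX m
  let Q := MvPolynomial (Fin m × ι) K ⧸ PXm X m
  let L := FractionRing Q
  let ev : MvPolynomial (Fin m × ι) K →ₐ[K] L :=
    (IsScalarTower.toAlgHom K Q L).comp (Ideal.Quotient.mkₐ K (PXm X m))
  have hev' : ∀ r, ev r = algebraMap Q L (Ideal.Quotient.mk _ r) := fun r => rfl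
  have hev : ∀ r, ev r = 0 ↔ r ∈ PXm X m := by
    intro r
    rw [hev', FaithfulSMul.algebraMap_eq_zero_iff, Ideal.Quotient.eq_zero_iff_mem]
  obtain ⟨ψ, hψ⟩ := ZD (ev.comp (PhiM m)) (secant m X) (by
    intro f hf
    rw [secant, Ivan_zclosure]
    rintro x ⟨S, hS, hc, hx⟩ v hv
    obtain ⟨w, hw, rfl⟩ := mem_secant_cone hS hc (hx hv)
    rw [← evt_PhiM]
    exact (hev _).1 hf w hw) d hd
  have hD : ∀ j, ∃ D : Derivation K L L, ∀ l, D (ev (PhiM m (ψ l))) = if l = j then 1 else 0 :=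
    fun j => exists_derivation _ hψ j
  choose D hD using hD
  obtain ⟨b, hb⟩ := IsLocalization.exist_integer_multiples_of_finite (nonZeroDivisors Q)
    (fun a : Fin (d + 1) × (Fin m × ι) => D a.1 (ev (MvPolynomial.X a.2)))
  obtain ⟨g, hg⟩ := Ideal.Quotient.mk_surjective (b : Q)
  have hW : ∀ a : Fin (d + 1) × (Fin m × ι), ∃ W, ev W = ev g * D a.1 (ev (MvPolynomial.X a.2)) := by
    intro a
    obtain ⟨q, hq⟩ := hb a
    obtain ⟨W, hW⟩ := Ideal.Quotient.mk_surjective q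
    refine ⟨W, ?_⟩
    rw [hev' W, hW, hq, hev' g, hg, Algebra.smul_def]
  choose W hW using hW
  have hg0 : ev g ≠ 0 := by
    rw [hev', hg]
    exact (FaithfulSMul.algebraMap_eq_zero_iff Q L).not.2 (nonZeroDivisors.ne_zero b.2)
  have hgen : ∀ (j) (r s : MvPolynomial (Fin m × ι) K), D j (ev r) * ev g = ev s →
      ∀ v : Fin m → ι → K, (∀ p, v p ∈ coneOf X) →
      ∑ c, evt v (MvPolynomial.pderiv c r) * evt v (W (j, c)) = evt v s := by
    intro j r s h v hv
    have h1 : ev (∑ c, MvPolynomial.pderiv c r * W (j, c) - s) = 0 := by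
      rw [map_sub, ← h, deriv_chain, map_sum, Finset.sum_mul, ← Finset.sum_sub_distrib]
      refine Finset.sum_eq_zero fun c _ => ?_
      rw [map_mul, hW]; ring
    have h2 := (hev _).1 h1 v hv
    rw [map_sub, sub_eq_zero, map_sum] at h2
    simpa only [map_mul] using h2
  refine ⟨g, ?_, ?_⟩
  · by_contra hh; push Not at hh; exact hg0 ((hev g).2 hh)
  · intro v hv hgv
    let z : Fin (d + 1) → (ι → K) := fun j => ∑ p, fun i => evt v (W (j, (p, i)))
    have hmem : ∀ j p, (fun i => evt v (W (j, (p, i)))) ∈ That X (v p) := by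
      intro j p f hf
      have hr : MvPolynomial.rename (fun i => (p, i)) f ∈ PXm X m := by
        intro w hw
        rw [evt, MvPolynomial.eval_rename]
        obtain ⟨x, hx, hwx⟩ := mem_coneOf.1 (hw p)
        exact hf.2 x hx _ hwx
      have h1 := hgen j (MvPolynomial.rename (fun i => (p, i)) f) 0 (by
        rw [(hev _).2 hr]; simp) v hv
      rw [map_zero, Fintype.sum_prod_type, Finset.sum_eq_single p] at h1
      · rw [← h1]
        refine Finset.sum_congr rfl fun i _ => ?_
        rw [mul_comm]
        congr 1
        have := MvPolynomial.pderiv_rename (R := K) (f := fun i : ι => (p, i)) (Prod.mk_right_injective p) i f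
        rw [this, evt, MvPolynomial.eval_rename]
        rfl
      · intro q _ hq
        refine Finset.sum_eq_zero fun i _ => ?_
        rw [MvPolynomial.pderiv_eq_zero_of_notMem_vars, map_zero, zero_mul]
        intro hmem
        have := MvPolynomial.vars_rename _ _ hmem
        simp only [Finset.mem_image, Prod.mk.injEq] at this
        obtain ⟨_, _, h, _⟩ := this
        exact hq h.symm
      · simp
    have hz : ∀ j, z j ∈ (⨆ p, That X (v p) : Submodule K (ι → K)) := fun j =>
      Submodule.sum_mem _ fun p _ => Submodule.mem_iSup_of_mem p (hmem j p)
    have hpair : ∀ j l, ∑ i, MvPolynomial.eval (∑ p, v p) (MvPolynomial.pderiv i (ψ l)) * z j i =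
        if l = j then evt v g else 0 := by
      intro j l
      have h1 := hgen j (PhiM m (ψ l)) (if l = j then g else 0) (by
        rw [hD]; split_ifs <;> simp) v hv
      rw [Fintype.sum_prod_type_right] at h1
      have h2 : evt v (if l = j then g else 0) = if l = j then evt v g else 0 := by
        split_ifs <;> simp
      rw [← h2, ← h1]
      refine Finset.sum_congr rfl fun i _ => ?_
      simp only [pderiv_PhiM, evt_PhiM, z, Finset.sum_apply, Finset.mul_sum]
    have hli : LinearIndependent K z := by
      rw [Fintype.linearIndependent_iff]
      intro c hc l
      have h1 : ∑ i, MvPolynomial.eval (∑ p, v p) (MvPolynomial.pderiv i (ψ l)) * (∑ j, c j • z j) i = 0 := by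
        rw [hc]; simp
      have h2 : ∑ i, MvPolynomial.eval (∑ p, v p) (MvPolynomial.pderiv i (ψ l)) * (∑ j, c j • z j) i =
          ∑ j, c j * ∑ i, MvPolynomial.eval (∑ p, v p) (MvPolynomial.pderiv i (ψ l)) * z j i := by
        simp only [Finset.sum_apply, Finset.mul_sum, Pi.smul_apply, smul_eq_mul]
        rw [Finset.sum_comm]
        refine Finset.sum_congr rfl fun j _ => Finset.sum_congr rfl fun i _ => by ring
      rw [h2] at h1
      simp only [hpair] at h1
      simpa [hgv] using h1
    have hli' : LinearIndependent K (fun j => (⟨z j, hz j⟩ : (⨆ p, That X (v p) : Submodule K (ι → K)))) :=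
      LinearIndependent.of_comp (Submodule.subtype _) hli
    simpa using hli'.fintype_card_le_finrank


theorem embTangentSpace_eq (X : Set (PP K ι)) (x : PP K ι) :
    embTangentSpace X x = PV (TT X x) := by
  ext y; rw [mem_PV]; rfl

/-- span of the tangent spaces -/
def MM (X A : Set (PP K ι)) : Submodule K (ι → K) := ⨆ a ∈ A, TT X a

theorem tangentSpan_eq (X A : Set (PP K ι)) : tangentSpan X A = PV (MM X A) := by
  rw [tangentSpan, projSpan_eq]
  congr 1
  apply le_antisymm
  · rw [vspan_le_iff]
    refine Set.iUnion₂_subset fun a ha => ?_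
    rw [embTangentSpace_eq]
    exact PV_mono (le_iSup₂_of_le (f := fun (a : PP K ι) (_ : a ∈ A) => TT X a) a ha le_rfl)
  · refine iSup₂_le fun a ha => ?_
    rw [← PV_subset_iff, ← embTangentSpace_eq]
    exact Set.Subset.trans (Set.subset_iUnion₂ (s := fun (a : PP K ι) (_ : a ∈ A) => embTangentSpace X a) a ha) (subset_PV_vspan _)

/-- the tangency locus, linear algebra form -/
def ZZ (n : ℕ) (X A : Set (PP K ι)) : Set (PP K ι) :=
  {x | x ∈ X ∧ Module.finrank K (TT X x) = n + 1 ∧ TT X x ≤ MM X A}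

theorem tangencyLocus_eq [Infinite K] {X : Set (PP K ι)} {n : ℕ}
    (hn : zdim X = ((n : ℕ∞) : WithBot ℕ∞)) (A : Set (PP K ι)) :
    tangencyLocus X A = ZZ n X A := by
  ext x
  simp only [tangencyLocus, IsSmoothPoint, ZZ, Set.mem_setOf_eq]
  rw [hn, embTangentSpace_eq, zdim_PV_iff, tangentSpan_eq, PV_subset_iff, and_assoc]

theorem dot_le {τ : Type*} [Fintype τ] (w : τ → ι → K) (hw : LinearIndependent K w)
    (T : Submodule K (ι → K)) (hT : ∀ t ∈ T, ∀ j, ∑ i, w j i * t i = 0) :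
    Module.finrank K T + Fintype.card τ ≤ Fintype.card ι := by
  classical
  have h1 := (Matrix.of w).mulVecLin.finrank_range_add_finrank_ker
  have h2 : Module.finrank K (Matrix.of w).mulVecLin.range = Fintype.card τ :=
    LinearIndependent.rank_matrix (M := Matrix.of w) hw
  have h3 : T ≤ (Matrix.of w).mulVecLin.ker := by
    intro t ht
    rw [LinearMap.mem_ker]
    funext j
    simpa [Matrix.mulVec, dotProduct] using hT t ht j
  have h4 := Submodule.finrank_mono h3
  rw [Module.finrank_fintype_fun_eq_card] at h1
  omega

theorem dot_ge {τ : Type*} [Fintype τ] (w : τ → ι → K) 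
    (T : Submodule K (ι → K)) (hT : ∀ t, (∀ j, ∑ i, w j i * t i = 0) → t ∈ T) :
    Fintype.card ι ≤ Module.finrank K T + Fintype.card τ := by
  classical
  have h1 := (Matrix.of w).mulVecLin.finrank_range_add_finrank_ker
  have h2 : Module.finrank K (Matrix.of w).mulVecLin.range ≤ Fintype.card τ := by
    have := Submodule.finrank_le (Matrix.of w).mulVecLin.range
    simpa using this
  have h3 : (Matrix.of w).mulVecLin.ker ≤ T := by
    intro t ht
    rw [LinearMap.mem_ker] at ht
    apply hT
    intro j
    have := congrFun ht j
    simpa [Matrix.mulVec, dotProduct] using this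
  have h4 := Submodule.finrank_mono h3
  rw [Module.finrank_fintype_fun_eq_card] at h1
  omega

theorem exists_dual {τ : Type*} [Fintype τ] [DecidableEq τ] (w : τ → ι → K)
    (hw : LinearIndependent K w) : ∃ B : ι → τ → K, ∀ j l, ∑ i, w j i * B i l = if j = l then 1 else 0 := by
  classical
  obtain ⟨g, hg⟩ := LinearMap.exists_leftInverse_of_injective (Fintype.linearCombination K w)
    (by
      rw [LinearMap.ker_eq_bot']
      intro c hc
      rw [Fintype.linearCombination_apply] at hc
      exact funext (Fintype.linearIndependent_iff.1 hw c hc))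
  refine ⟨fun i => g (Pi.single i 1), fun j l => ?_⟩
  have h1 : g (w j) = Pi.single j 1 := by
    have := LinearMap.congr_fun hg (Pi.single j 1)
    simpa [Fintype.linearCombination_apply_single] using this
  have h2 : g (w j) = ∑ i, w j i • g (Pi.single i 1) := by
    conv_lhs => rw [pi_eq_sum_univ' (w j)]
    rw [map_sum]
    simp only [map_smul]
  have h3 := congrFun (h2.symm.trans h1) l
  simp only [Finset.sum_apply, Pi.smul_apply, smul_eq_mul] at h3
  rw [h3, Pi.single_apply]
  simp [eq_comm]

theorem semicont [Infinite K] {τ : Type*} [Fintype τ] (x0 : PP K ι)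
    (h : τ → ι → MvPolynomial ι K)
    (hli : LinearIndependent K (fun j i => MvPolynomial.eval x0.rep (h j i))) :
    ∃ E, IsZClosed E ∧ x0 ∉ E ∧ ∀ x ∉ E, ∃ v ∈ x.submodule, v ≠ 0 ∧
      LinearIndependent K (fun j i => MvPolynomial.eval v (h j i)) := by
  classical
  obtain ⟨B, hB⟩ := exists_dual _ hli
  obtain ⟨i0, hi0⟩ := Function.ne_iff.1 x0.rep_nonzero
  let Mx : Matrix τ τ (MvPolynomial ι K) := Matrix.of fun j l => ∑ i, h j i * MvPolynomial.C (B i l)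
  have hM : ∀ v, MvPolynomial.eval v Mx.det = (Matrix.of fun j l => ∑ i, MvPolynomial.eval v (h j i) * B i l).det := by
    intro v
    rw [RingHom.map_det]
    congr 1
    ext j l
    simp [Mx]
  refine ⟨zeroLocus {Mx.det * MvPolynomial.X i0}, isZClosed_zeroLocus _, ?_, ?_⟩
  · intro hx
    have := hx _ rfl _ (rep_mem x0)
    rw [map_mul, hM] at this
    have h1 : (Matrix.of fun j l => ∑ i, MvPolynomial.eval x0.rep (h j i) * B i l) = (1 : Matrix τ τ K) := by
      ext j l
      rw [Matrix.of_apply, hB, Matrix.one_apply]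
    rw [h1, Matrix.det_one, one_mul, MvPolynomial.eval_X] at this
    exact hi0 this
  · intro x hx
    simp only [zeroLocus, Set.mem_setOf_eq, not_forall, Set.mem_singleton_iff] at hx
    obtain ⟨f, rfl, v, hv, hne⟩ := hx
    rw [map_mul, hM] at hne
    refine ⟨v, hv, ?_, ?_⟩
    · rintro rfl
      simp at hne
    · have hd := left_ne_zero_of_mul hne
      rw [Fintype.linearIndependent_iff]
      intro c hc
      have : c = 0 := by
        apply Matrix.eq_zero_of_vecMul_eq_zero hd
        funext l
        simp only [Matrix.vecMul, dotProduct, Matrix.of_apply, Pi.zero_apply, Finset.mul_sum]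
        rw [Finset.sum_comm]
        refine Finset.sum_eq_zero fun i _ => ?_
        have := congrFun hc i
        simp only [Finset.sum_apply, Pi.smul_apply, smul_eq_mul, Pi.zero_apply] at this
        simp only [← mul_assoc]
        rw [← Finset.sum_mul, this, zero_mul]
      intro i; rw [this]; rfl

theorem exists_eqs (X : Set (PP K ι)) (x0 : PP K ι) :
    ∃ (q : ℕ) (f : Fin q → MvPolynomial ι K), (∀ j, f j ∈ homogVanishingIdeal X) ∧
      LinearIndependent K (fun j i => MvPolynomial.eval x0.rep (MvPolynomial.pderiv i (f j))) ∧
      (∀ t, (∀ j, ∑ i, MvPolynomial.eval x0.rep (MvPolynomial.pderiv i (f j)) * t i = 0) →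
        t ∈ TT X x0) ∧
      Module.finrank K (TT X x0) + q = Fintype.card ι := by
  classical
  let 𝒟 : Set (ι → K) := {w | ∃ f ∈ homogVanishingIdeal X,
    w = fun i => MvPolynomial.eval x0.rep (MvPolynomial.pderiv i f)}
  obtain ⟨b, hb, hspan, hli⟩ := exists_linearIndependent K 𝒟
  haveI : Finite b := hli.finite
  haveI := Fintype.ofFinite b
  let e := (Fintype.equivFin b).symm
  choose f hf1 hf2 using fun j => hb (e j).2
  have hli' : LinearIndependent K (fun j i => MvPolynomial.eval x0.rep (MvPolynomial.pderiv i (f j))) := by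
    have := hli.comp e e.injective
    have h2 : (fun j i => MvPolynomial.eval x0.rep (MvPolynomial.pderiv i (f j))) =
        Subtype.val ∘ e := by
      funext j
      exact (hf2 j).symm
    rw [h2]; exact this
  have hT : ∀ t, (∀ j, ∑ i, MvPolynomial.eval x0.rep (MvPolynomial.pderiv i (f j)) * t i = 0) →
        t ∈ TT X x0 := by
    intro t ht g hg
    let lin : (ι → K) →ₗ[K] K := ∑ i, t i • LinearMap.proj i
    have hlin : ∀ w, lin w = ∑ i, t i * w i := by intro w; simp [lin]
    have hle : Submodule.span K 𝒟 ≤ LinearMap.ker lin := by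
      rw [← hspan, Submodule.span_le]
      intro w hw
      rw [SetLike.mem_coe, LinearMap.mem_ker, hlin]
      obtain ⟨j, hj⟩ := e.surjective ⟨w, hw⟩
      have h1 := hf2 j
      rw [hj] at h1
      simp only at h1
      rw [h1]
      rw [← ht j]
      exact Finset.sum_congr rfl fun i _ => mul_comm _ _
    have := hle (Submodule.subset_span (⟨g, hg, rfl⟩ : _ ∈ 𝒟))
    rw [LinearMap.mem_ker, hlin] at this
    exact this
  refine ⟨Fintype.card b, f, hf1, hli', hT, ?_⟩
  have h1 := dot_le _ hli' (TT X x0) (by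
    intro t ht j
    rw [← ht (f j) (hf1 j)]
    exact Finset.sum_congr rfl fun i _ => mul_comm _ _)
  have h2 := dot_ge _ (TT X x0) hT
  rw [Fintype.card_fin] at h1 h2
  omega

theorem SC2 [Infinite K] (X : Set (PP K ι)) (x0 : PP K ι) :
    ∃ E, IsZClosed E ∧ x0 ∉ E ∧ ∀ x ∉ E,
      Module.finrank K (TT X x) ≤ Module.finrank K (TT X x0) := by
  obtain ⟨q, f, hf, hli, -, hfr⟩ := exists_eqs X x0
  obtain ⟨E, hE, hx0, h⟩ := semicont x0 (fun j i => MvPolynomial.pderiv i (f j)) hli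
  refine ⟨E, hE, hx0, fun x hx => ?_⟩
  obtain ⟨v, hv, h0, hl⟩ := h x hx
  have := dot_le _ hl (TT X x) (by
    intro t ht j
    rw [TT_eq X hv h0] at ht
    rw [← ht (f j) (hf j)]
    exact Finset.sum_congr rfl fun i _ => mul_comm _ _)
  rw [Fintype.card_fin] at this
  omega

theorem SC3 [Infinite K] (X : Set (PP K ι)) (x0 : PP K ι) (M : Submodule K (ι → K))
    (hM : ¬ TT X x0 ≤ M) :
    ∃ E, IsZClosed E ∧ x0 ∉ E ∧ ∀ x ∉ E,
      Module.finrank K (TT X x) = Module.finrank K (TT X x0) → ¬ TT X x ≤ M := by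
  obtain ⟨w, hw, hwM⟩ := SetLike.not_le_iff_exists.1 hM
  obtain ⟨c, hc, hcw⟩ := exists_sep hwM
  obtain ⟨q, f, hf, hli, -, hfr⟩ := exists_eqs X x0
  let h : Option (Fin q) → ι → MvPolynomial ι K := fun o i =>
    Option.casesOn' o (MvPolynomial.C (c i)) (fun j => MvPolynomial.pderiv i (f j))
  have hli' : LinearIndependent K (fun j i => MvPolynomial.eval x0.rep (h j i)) := by
    have h1 := (linearIndependent_option' (K := K) (x := c)
      (v := fun j i => MvPolynomial.eval x0.rep (MvPolynomial.pderiv i (f j)))).2 ⟨hli, ?_⟩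
    · have h2 : (fun j i => MvPolynomial.eval x0.rep (h j i)) = fun o => Option.casesOn' o c
          (fun j i => MvPolynomial.eval x0.rep (MvPolynomial.pderiv i (f j))) := by
        funext o
        cases o <;> simp [h]
      rw [h2]; exact h1
    · intro hcs
      let lin : (ι → K) →ₗ[K] K := ∑ i, w i • LinearMap.proj i
      have hlin : ∀ u, lin u = ∑ i, w i * u i := by intro u; simp [lin]
      have hle : Submodule.span K (Set.range fun j i => MvPolynomial.eval x0.rep (MvPolynomial.pderiv i (f j))) ≤ LinearMap.ker lin := by
        rw [Submodule.span_le]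
        rintro _ ⟨j, rfl⟩
        rw [SetLike.mem_coe, LinearMap.mem_ker, hlin]
        exact hw (f j) (hf j)
      have := hle hcs
      rw [LinearMap.mem_ker, hlin] at this
      apply hcw
      rw [← this]
      exact Finset.sum_congr rfl fun i _ => mul_comm _ _
  obtain ⟨E, hE, hx0, hh⟩ := semicont x0 h hli'
  refine ⟨E, hE, hx0, fun x hx heq hle => ?_⟩
  obtain ⟨v, hv, h0, hl⟩ := hh x hx
  have := dot_le _ hl (TT X x) (by
    intro t ht j
    cases j with
    | none => simpa [h] using hc t (hle ht)
    | some j =>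
      rw [TT_eq X hv h0] at ht
      rw [← ht (f j) (hf j)]
      exact Finset.sum_congr rfl fun i _ => by simp [h, mul_comm])
  rw [Fintype.card_option, Fintype.card_fin] at this
  omega

theorem closure_ZZ [Infinite K] {X B U : Set (PP K ι)} {n : ℕ} (hX : IsZClosed X) (hU : U ⊆ ZZ n X B)
    {x0 : PP K ι} (hx0 : x0 ∈ zclosure U) :
    x0 ∈ X ∧ n + 1 ≤ Module.finrank K (TT X x0) ∧
      (Module.finrank K (TT X x0) = n + 1 → x0 ∈ ZZ n X B) := by
  have hnot : ∀ E, IsZClosed E → x0 ∉ E → ∃ x ∈ U, x ∉ E := by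
    intro E hE hx
    by_contra hc
    push Not at hc
    exact hx (zclosure_min hE hc hx0)
  have hxX : x0 ∈ X := zclosure_min hX (fun x hx => (hU hx).1) hx0
  refine ⟨hxX, ?_, fun h => ⟨hxX, h, ?_⟩⟩
  · obtain ⟨E, hE, hxE, h⟩ := SC2 X x0
    obtain ⟨x, hx, hxE'⟩ := hnot E hE hxE
    rw [← (hU hx).2.1]
    exact h x hxE'
  · by_contra hle
    obtain ⟨E, hE, hxE, hh⟩ := SC3 X x0 _ hle
    obtain ⟨x, hx, hxE'⟩ := hnot E hE hxE
    exact hh x hxE' ((hU hx).2.1.trans h.symm) (hU hx).2.2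


theorem finrank_iSup_iff {V : Type*} [AddCommGroup V] [Module K V] [FiniteDimensional K V] {m : ℕ}
    (W : Fin m → Submodule K V) :
    Module.finrank K (⨆ i, W i : Submodule K V) = ∑ i, Module.finrank K (W i) ↔ iSupIndep W := by
  classical
  let f : (Π₀ i, W i) →ₗ[K] V := DFinsupp.lsum ℕ (fun i => (W i).subtype)
  have hr : (⨆ i, W i : Submodule K V) = LinearMap.range f := Submodule.iSup_eq_range_dfinsupp_lsum W
  have hd : Module.finrank K (Π₀ i, W i) = ∑ i, Module.finrank K (W i) :=
    Module.finrank_directSum K (fun i => W i)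
  haveI : FiniteDimensional K (Π₀ i, W i) := 
    Module.Finite.equiv (DFinsupp.linearEquivFunOnFintype (R := K) (M := fun i => W i)).symm
  have h1 := f.finrank_range_add_finrank_ker
  rw [hr, ← hd]
  constructor
  · intro h
    apply iSupIndep_of_dfinsupp_lsum_injective
    have h2 : LinearMap.ker f = ⊥ := by
      rw [← Submodule.finrank_eq_zero (R := K)]; omega
    exact LinearMap.ker_eq_bot.1 h2
  · intro h
    have h2 : LinearMap.ker f = ⊥ := LinearMap.ker_eq_bot.2 h.dfinsupp_lsum_injective
    rw [h2, finrank_bot] at h1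
    omega

theorem vspan_iUnion_PV {m : ℕ} (W : Fin m → Submodule K (ι → K)) :
    vspan (⋃ i, PV (W i)) = ⨆ i, W i := by
  apply le_antisymm
  · rw [vspan_le_iff]
    exact Set.iUnion_subset fun i => PV_mono (le_iSup W i)
  · refine iSup_le fun i => ?_
    rw [← PV_subset_iff]
    exact (Set.subset_iUnion (fun i => PV (W i)) i).trans (subset_PV_vspan _)

theorem indep_eq {m : ℕ} {W : Fin m → Submodule K (ι → K)} (hW : iSupIndep W) {x : PP K ι}
    {i j : Fin m} (hi : x ∈ PV (W i)) (hj : x ∈ PV (W j)) : i = j := by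
  by_contra hne
  have := (hW.pairwiseDisjoint hne).le_bot ⟨mem_PV.1 hi, mem_PV.1 hj⟩
  exact x.rep_nonzero (by simpa using this)

theorem D5 [Infinite K] {X : Set (PP K ι)} {n : ℕ}
    (hn : zdim X = ((n : ℕ∞) : WithBot ℕ∞)) {m : ℕ} (u : Fin m → PP K ι)
    (h : ComponentsAreIndepLinear (contactLocus X (Set.range u)) m) :
    ∃ W : Fin m → Submodule K (ι → K), iSupIndep W ∧ ∀ i, u i ∈ ZZ n X (Set.range u) ∧
      u i ∈ PV (W i) ∧ (∃ U ⊆ ZZ n X (Set.range u), zclosure U = PV (W i)) ∧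
      ∀ D, IsZIrreducible D → D ⊆ ZZ n X (Set.range u) → u i ∈ D → D ⊆ PV (W i) := by
  classical
  obtain ⟨C, hinj, hcomp, hlin, hfr⟩ := h
  rw [contactLocus, tangencyLocus_eq hn] at hcomp hfr
  set Z := ZZ n X (Set.range u) with hZ
  set 𝒞 : Set (Set (PP K ι)) := {C : Set (PP K ι) |
    IsZIrredComponent Z C ∧ (C ∩ Set.range u).Nonempty} with h𝒞
  set Γ := zclosure (⋃ C ∈ 𝒞, C) with hΓ
  have hCc : ∀ j, IsZIrredComponent Γ (C j) := fun j => (hcomp _).2 ⟨j, rfl⟩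
  have hCV : ∀ j, C j = PV (vspan (C j)) := fun j => hlin j
  have hCcl : ∀ j, IsZClosed (C j) := fun j => by rw [hCV]; exact isZClosed_PV _
  have hΓU : Γ = ⋃ j, C j := by
    apply Set.Subset.antisymm
    · intro x hx
      obtain ⟨D, hD, hxD⟩ := exists_component (irreducible_singleton x) (Set.singleton_subset_iff.2 hx)
      obtain ⟨j, rfl⟩ := (hcomp D).1 hD
      exact Set.mem_iUnion.2 ⟨j, hxD rfl⟩
    · exact Set.iUnion_subset fun j => (hCc j).2.1
  have hind : iSupIndep (fun j => vspan (C j)) := by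
    rw [← finrank_iSup_iff, ← hfr, hΓU, Set.iUnion_congr hCV, vspan_iUnion_PV]
  have hin : ∀ C' ∈ 𝒞, ∃ j, C' ⊆ C j := by
    intro C' hC'
    refine hC'.1.1.finite_union C hCcl ?_
    rw [← hΓU]
    exact (Set.subset_iUnion₂ (s := fun (C : Set (PP K ι)) (_ : C ∈ 𝒞) => C) C' hC').trans (subset_zclosure _)
  let U : Fin m → Set (PP K ι) := fun j => ⋃ C' ∈ {C' ∈ 𝒞 | C' ⊆ C j}, C'
  have hUC : ∀ j, U j ⊆ C j := fun j => Set.iUnion₂_subset fun C' h => h.2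
  have hUZ : ∀ j, U j ⊆ Z := fun j => Set.iUnion₂_subset fun C' h => h.1.1.2.1
  have hΓ2 : Γ ⊆ ⋃ j, zclosure (U j) := by
    refine zclosure_min (isZClosed_iUnion _ fun j => isZClosed_zclosure _) ?_
    refine Set.iUnion₂_subset fun C' hC' => ?_
    obtain ⟨j, hj⟩ := hin C' hC'
    refine Set.Subset.trans ?_ (Set.subset_iUnion _ j)
    exact (Set.subset_iUnion₂ (s := fun (C' : Set (PP K ι)) (_ : C' ∈ {C' ∈ 𝒞 | C' ⊆ C j}) => C') C' ⟨hC', hj⟩).trans (subset_zclosure _)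
  have hcl : ∀ j, zclosure (U j) = C j := by
    intro j
    obtain ⟨l, hl⟩ := (hCc j).1.finite_union _ (fun j => isZClosed_zclosure (U j)) ((hCc j).2.1.trans hΓ2)
    have h1 : zclosure (U l) ⊆ C l := zclosure_min (hCcl l) (hUC l)
    have h2 : C j = C l := (hCc j).2.2 _ (hCc l).1 (hCc l).2.1 (hl.trans h1)
    have h3 := hinj h2
    subst h3
    exact h1.antisymm hl
  have hs : ∀ j, ∃ i, u i ∈ C j ∧ u i ∈ Z := by
    intro j
    by_contra hc
    have : U j = ∅ := by
      rw [Set.eq_empty_iff_forall_notMem]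
      intro x hx
      obtain ⟨C', hC', hxC⟩ := Set.mem_iUnion₂.1 hx
      obtain ⟨_, hy, i, rfl⟩ := hC'.1.2
      exact hc ⟨i, hC'.2 hy, hC'.1.1.2.1 hy⟩
    have h1 := hcl j
    rw [this, zclosure_eq isZClosed_empty] at h1
    have := (hCc j).1.1
    rw [← h1] at this
    exact Set.not_nonempty_empty this
  choose s hs1 hs2 using hs
  have hmem : ∀ j l x, x ∈ C j → x ∈ C l → j = l := by
    intro j l x hj hl
    rw [hCV] at hj hl
    exact indep_eq hind hj hl
  have hsinj : Function.Injective s := fun j l hjl => hmem j l (u (s j)) (hs1 j) (by rw [hjl]; exact hs1 l)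
  let e : Fin m ≃ Fin m := Equiv.ofBijective s (Finite.injective_iff_bijective.1 hsinj)
  have he : ∀ i, s (e.symm i) = i := fun i => e.apply_symm_apply i
  refine ⟨fun i => vspan (C (e.symm i)), hind.comp e.symm.injective, fun i => ⟨?_, ?_, ?_, ?_⟩⟩
  · have := hs2 (e.symm i); rwa [he] at this
  · rw [← hCV]; have := hs1 (e.symm i); rwa [he] at this
  · exact ⟨U (e.symm i), hUZ _, by rw [← hCV]; exact hcl _⟩
  · intro D hD hDZ hi
    obtain ⟨C', hC', hDC⟩ := exists_component hD hDZ
    obtain ⟨l, hl⟩ := hin C' ⟨hC', u i, hDC hi, i, rfl⟩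
    have h1 : u i ∈ C (e.symm i) := by have := hs1 (e.symm i); rwa [he] at this
    have h2 := hmem _ _ (u i) h1 (hl (hDC hi))
    rw [← hCV, h2]
    exact hDC.trans hl

theorem D7 [Infinite K] {X : Set (PP K ι)} {n : ℕ}
    (hn : zdim X = ((n : ℕ∞) : WithBot ℕ∞)) {k : ℕ} (a : Fin k → PP K ι)
    (N : Fin k → Submodule K (ι → K)) (hN : iSupIndep N) (Cc : Fin k → Set (PP K ι))
    (hirr : ∀ i, IsZIrreducible (Cc i)) (hCZ : ∀ i, Cc i ⊆ ZZ n X (Set.range a))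
    (ha : ∀ i, a i ∈ Cc i)
    (hmax : ∀ i D, IsZIrreducible D → D ⊆ ZZ n X (Set.range a) → a i ∈ D → D ⊆ Cc i)
    (hcl : ∀ i, zclosure (Cc i) = PV (N i)) :
    ComponentsAreIndepLinear (contactLocus X (Set.range a)) k := by
  have hU : (⋃ C ∈ {C : Set (PP K ι) |
      IsZIrredComponent (tangencyLocus X (Set.range a)) C ∧ (C ∩ Set.range a).Nonempty}, C) =
      ⋃ i, Cc i := by
    rw [tangencyLocus_eq hn]
    apply Set.Subset.antisymm
    · refine Set.iUnion₂_subset fun C hC => ?_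
      obtain ⟨_, hy, i, rfl⟩ := hC.2
      exact (hmax i C hC.1.1 hC.1.2.1 hy).trans (Set.subset_iUnion Cc i)
    · refine Set.iUnion_subset fun i => ?_
      intro x hx
      refine Set.mem_iUnion₂.2 ⟨Cc i, ⟨⟨hirr i, hCZ i, fun D hD hDZ hCD => ?_⟩, a i, ha i, i, rfl⟩, hx⟩
      exact hCD.antisymm (hmax i D hD hDZ (hCD (ha i)))
  have hΓ : contactLocus X (Set.range a) = ⋃ i, PV (N i) := by
    rw [contactLocus, hU]
    apply Set.Subset.antisymm
    · refine zclosure_min (isZClosed_iUnion _ fun i => isZClosed_PV _) ?_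
      exact Set.iUnion_mono fun i => by rw [← hcl]; exact subset_zclosure _
    · refine Set.iUnion_subset fun i => ?_
      rw [← hcl]
      exact zclosure_min (isZClosed_zclosure _) ((Set.subset_iUnion Cc i).trans (subset_zclosure _))
  have hi : ∀ i, a i ∈ PV (N i) := fun i => by rw [← hcl]; exact subset_zclosure _ (ha i)
  have hirrN : ∀ i, IsZIrreducible (PV (N i)) := fun i => by rw [← hcl]; exact (hirr i).closure
  have hsub : ∀ i j, PV (N i) ⊆ PV (N j) → i = j := fun i j h => indep_eq hN (hi i) (h (hi i))
  rw [hΓ]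
  have hcompo : ∀ i, IsZIrredComponent (⋃ i, PV (N i)) (PV (N i)) := by
    intro i
    refine ⟨hirrN i, Set.subset_iUnion (fun i => PV (N i)) i, fun D hD hDU hiD => ?_⟩
    obtain ⟨j, hj⟩ := hD.finite_union _ (fun j => isZClosed_PV (N j)) hDU
    have := hsub i j (hiD.trans hj)
    subst this
    exact hiD.antisymm hj
  refine ⟨fun i => PV (N i), fun i j h => hsub i j (le_of_eq h), fun D => ⟨fun hD => ?_, ?_⟩, ?_, ?_⟩
  · obtain ⟨j, hj⟩ := hD.1.finite_union _ (fun j => isZClosed_PV (N j)) hD.2.1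
    exact ⟨j, hD.2.2 _ (hirrN j) (hcompo j).2.1 hj⟩
  · rintro ⟨i, rfl⟩; exact hcompo i
  · intro i
    rw [IsProjLinear, projSpan_eq, vspan_PV]
  · rw [vspan_iUnion_PV]
    rw [(finrank_iSup_iff N).2 hN]
    exact Finset.sum_congr rfl fun i _ => by rw [vspan_PV]


theorem finrank_iSup_le {V : Type*} [AddCommGroup V] [Module K V] [FiniteDimensional K V] {m : ℕ}
    (W : Fin m → Submodule K V) :
    Module.finrank K (⨆ i, W i : Submodule K V) ≤ ∑ i, Module.finrank K (W i) := by
  classical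
  let f : (Π₀ i, W i) →ₗ[K] V := DFinsupp.lsum ℕ (fun i => (W i).subtype)
  have hr : (⨆ i, W i : Submodule K V) = LinearMap.range f := Submodule.iSup_eq_range_dfinsupp_lsum W
  have hd : Module.finrank K (Π₀ i, W i) = ∑ i, Module.finrank K (W i) :=
    Module.finrank_directSum K (fun i => W i)
  haveI : FiniteDimensional K (Π₀ i, W i) := 
    Module.Finite.equiv (DFinsupp.linearEquivFunOnFintype (R := K) (M := fun i => W i)).symm
  have h1 := f.finrank_range_add_finrank_ker
  rw [hr, ← hd]
  omega

theorem rep_mem_TT {X : Set (PP K ι)} {x : PP K ι} (hx : x ∈ X) : x.rep ∈ TT X x := by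
  intro f hf
  obtain ⟨⟨d, hd⟩, hv⟩ := hf
  have := congrArg (MvPolynomial.eval x.rep) hd.sum_X_mul_pderiv
  rw [map_sum, map_nsmul, hv x hx _ (rep_mem x), smul_zero] at this
  simpa using this

theorem Gen.all [Infinite K] {X : Set (PP K ι)} (hX : IsZIrreducible X) {m : ℕ} {α : Type*} [Fintype α]
    {P : α → (Fin m → PP K ι) → Prop} (h : ∀ a, Gen X m (P a)) :
    Gen X m (fun u => ∀ a, P a u) := by
  classical
  have : ∀ s : Finset α, Gen X m (fun u => ∀ a ∈ s, P a u) := by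
    intro s
    induction s using Finset.induction_on with
    | empty =>
      obtain ⟨q, hq, -⟩ := exists_nonzero_witness hX (m := m)
      exact ⟨q, hq, fun _ _ _ _ => by simp⟩
    | insert a s ha ih =>
      refine ((h a).and hX ih).mono fun u _ hu b hb => ?_
      rcases Finset.mem_insert.1 hb with rfl | hb
      · exact hu.1
      · exact hu.2 b hb
  exact (this Finset.univ).mono fun u _ hu a => hu a (Finset.mem_univ a)

theorem MM_range {X : Set (PP K ι)} {m : ℕ} (a : Fin m → PP K ι) :
    MM X (Set.range a) = ⨆ i, TT X (a i) := by
  rw [MM, iSup_range]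

theorem PV_submodule (x : PP K ι) : PV x.submodule = {x} := by
  ext y
  constructor
  · intro hy
    have := mk_of_mem (mem_PV.1 hy) y.rep_nonzero
    rw [Projectivization.mk_rep] at this
    exact this
  · rintro rfl; exact le_refl y.submodule

/-- the index maps -/
def eMap (k : ℕ) {n : ℕ} (j : Fin n) : Fin (k + 1) → Fin (k + n) :=
  Fin.snoc (α := fun _ => Fin (k + n)) (fun i => Fin.castAdd n i) (Fin.natAdd k j)

theorem eMap_castSucc (k : ℕ) {n : ℕ} (j : Fin n) (i : Fin k) :
    eMap k j (Fin.castSucc i) = Fin.castAdd n i := by simp [eMap]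

theorem eMap_last (k : ℕ) {n : ℕ} (j : Fin n) :
    eMap k j (Fin.last k) = Fin.natAdd k j := by simp [eMap]

theorem eMap_inj (k : ℕ) {n : ℕ} (j : Fin n) : Function.Injective (eMap k j) := by
  intro a b
  refine Fin.lastCases ?_ (fun a => ?_) a <;> refine Fin.lastCases ?_ (fun b => ?_) b
  · simp
  · rw [eMap_castSucc, eMap_last]
    intro h
    have := congrArg Fin.val h
    simp at this; omega
  · rw [eMap_castSucc, eMap_last]
    intro h
    have := congrArg Fin.val h
    simp at this; omega
  · rw [eMap_castSucc, eMap_castSucc]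
    intro h
    have := congrArg Fin.val h
    simp at this
    rw [Fin.ext this]

theorem MM_eMap {X : Set (PP K ι)} {k n : ℕ} (w : Fin (k + n) → PP K ι) (j : Fin n) :
    MM X (Set.range fun p => w (eMap k j p)) =
      MM X (Set.range fun i : Fin k => w (Fin.castAdd n i)) ⊔ TT X (w (Fin.natAdd k j)) := by
  rw [MM_range, MM_range]
  apply le_antisymm
  · refine iSup_le fun p => ?_
    refine Fin.lastCases ?_ (fun i => ?_) p
    · rw [eMap_last]; exact le_sup_right
    · rw [eMap_castSucc]
      exact le_sup_of_le_left (le_iSup (fun i => TT X (w (Fin.castAdd n i))) i)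
  · refine sup_le (iSup_le fun i => ?_) ?_
    · have := le_iSup (fun p => TT X (w (eMap k j p))) (Fin.castSucc i)
      simpa only [eMap_castSucc] using this
    · have := le_iSup (fun p => TT X (w (eMap k j p))) (Fin.last k)
      simpa only [eMap_last] using this

theorem main2 [Infinite K] {X : Set (PP K ι)} {n k : ℕ} (hXc : IsZClosed X)
    (hn : zdim X = ((n : ℕ∞) : WithBot ℕ∞)) (w : Fin (k + n) → PP K ι)
    (hrank : (k + n) * (n + 1) ≤ Module.finrank K (⨆ p, TT X (w p) : Submodule K (ι → K)))
    (h2 : 2 ≤ n)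
    (hC : ∀ j : Fin n, ComponentsAreIndepLinear
      (contactLocus X (Set.range fun p => w (eMap k j p))) (k + 1)) :
    ComponentsAreIndepLinear (contactLocus X (Set.range fun i : Fin k => w (Fin.castAdd n i))) k := by
  have hD := fun j => D5 hn _ (hC j)
  choose W hWi hW using hD
  have j0 : Fin n := ⟨0, by omega⟩
  set A := MM X (Set.range fun i : Fin k => w (Fin.castAdd n i)) with hA
  have hsm : ∀ p, Module.finrank K (TT X (w p)) = n + 1 := by
    intro p
    refine Fin.addCases (fun i => ?_) (fun j => ?_) p
    · have := (hW j0 (Fin.castSucc i)).1.2.1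
      rwa [eMap_castSucc] at this
    · have := (hW j (Fin.last k)).1.2.1
      rwa [eMap_last] at this
  have hXa : ∀ i : Fin k, w (Fin.castAdd n i) ∈ X := by
    intro i
    have := (hW j0 (Fin.castSucc i)).1.1
    rwa [eMap_castSucc] at this
  have hind : iSupIndep (fun p => TT X (w p)) := by
    rw [← finrank_iSup_iff]
    refine le_antisymm (finrank_iSup_le _) ?_
    simp only [hsm]
    simpa using hrank
  let P : Fin n := ⟨0, by omega⟩
  let Q : Fin n := ⟨1, by omega⟩
  have hmod : (A ⊔ TT X (w (Fin.natAdd k P))) ⊓ (A ⊔ TT X (w (Fin.natAdd k Q))) ≤ A := by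
    rw [sup_inf_assoc_of_le _ (le_sup_left : A ≤ A ⊔ TT X (w (Fin.natAdd k Q)))]
    refine sup_le le_rfl ?_
    have hdis := hind (Fin.natAdd k P)
    have hle : A ⊔ TT X (w (Fin.natAdd k Q)) ≤ ⨆ j, ⨆ (_ : j ≠ Fin.natAdd k P), TT X (w j) := by
      refine sup_le ?_ ?_
      · rw [hA, MM_range]
        refine iSup_le fun i => ?_
        refine le_iSup₂_of_le (f := fun j (_ : j ≠ Fin.natAdd k P) => TT X (w j)) (Fin.castAdd n i) ?_ le_rfl
        intro h
        have := congrArg Fin.val h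
        simp at this; omega
      · refine le_iSup₂_of_le (f := fun j (_ : j ≠ Fin.natAdd k P) => TT X (w j)) (Fin.natAdd k Q) ?_ le_rfl
        intro h
        have := congrArg Fin.val h
        simp [P, Q] at this
    exact ((hdis.mono_right hle).le_bot).trans bot_le
  have hWmem : ∀ (j : Fin n) (i : Fin k), w (Fin.castAdd n i) ∈ PV (W j (Fin.castSucc i)) := by
    intro j i
    have := (hW j (Fin.castSucc i)).2.1
    rwa [eMap_castSucc] at this
  have hWcl : ∀ (j : Fin n) (i : Fin k) x, x ∈ PV (W j (Fin.castSucc i)) → x ∈ X ∧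
      n + 1 ≤ Module.finrank K (TT X x) ∧ (Module.finrank K (TT X x) = n + 1 →
        TT X x ≤ A ⊔ TT X (w (Fin.natAdd k j))) := by
    intro j i x hx
    obtain ⟨U, hU, hUcl⟩ := (hW j (Fin.castSucc i)).2.2.1
    rw [← hUcl] at hx
    obtain ⟨a, b, c⟩ := closure_ZZ hXc hU hx
    refine ⟨a, b, fun h => ?_⟩
    have := (c h).2.2
    rwa [MM_eMap] at this
  have hWmax : ∀ (j : Fin n) (i : Fin k) D, IsZIrreducible D →
      D ⊆ ZZ n X (Set.range fun i : Fin k => w (Fin.castAdd n i)) → w (Fin.castAdd n i) ∈ D →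
      D ⊆ PV (W j (Fin.castSucc i)) := by
    intro j i D hD hDZ hi
    refine (hW j (Fin.castSucc i)).2.2.2 D hD ?_ (by rwa [eMap_castSucc])
    intro x hx
    refine ⟨(hDZ hx).1, (hDZ hx).2.1, (hDZ hx).2.2.trans ?_⟩
    rw [MM_eMap]
    exact le_sup_left
  let N : Fin k → Submodule K (ι → K) := fun i => W P (Fin.castSucc i) ⊓ W Q (Fin.castSucc i)
  have haN : ∀ i, w (Fin.castAdd n i) ∈ PV (N i) := fun i =>
    mem_PV.2 ⟨mem_PV.1 (hWmem P i), mem_PV.1 (hWmem Q i)⟩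
  let Cc : Fin k → Set (PP K ι) := fun i => PV (N i) ∩ {x | Module.finrank K (TT X x) = n + 1}
  have haC : ∀ i, w (Fin.castAdd n i) ∈ Cc i := fun i => ⟨haN i, hsm _⟩
  have hNne : ∀ i, N i ≠ ⊥ := by
    intro i h
    have := mem_PV.1 (haN i)
    rw [h, Submodule.mem_bot] at this
    exact (w (Fin.castAdd n i)).rep_nonzero this
  have hcl : ∀ i, zclosure (Cc i) = PV (N i) := by
    intro i
    apply Set.Subset.antisymm (zclosure_min (isZClosed_PV _) Set.inter_subset_left)
    obtain ⟨E, hE, hxE, hh⟩ := SC2 X (w (Fin.castAdd n i))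
    rw [hsm] at hh
    rcases (irreducible_PV (hNne i)).2 E (zclosure (Cc i)) hE (isZClosed_zclosure _) (by
      intro x hx
      by_cases hxe : x ∈ E
      · exact Or.inl hxe
      · refine Or.inr (subset_zclosure _ ⟨hx, ?_⟩)
        have := (hWcl P i x (PV_mono inf_le_left hx)).2.1
        exact le_antisymm (hh x hxe) this) with h | h
    · exact absurd (h (haN i)) hxE
    · exact h
  refine D7 hn _ N ?_ Cc ?_ ?_ haC ?_ hcl
  · exact ((hWi P).comp (Fin.castSucc_injective k)).mono fun i => inf_le_left
  · intro i
    refine irreducible_of_prime ⟨_, haC i⟩ ?_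
    rw [← Ivan_zclosure, hcl]
    exact (irreducible_PV (hNne i)).prime
  · rintro i x ⟨hx, hfx⟩
    refine ⟨(hWcl P i x (PV_mono inf_le_left hx)).1, hfx, ?_⟩
    exact (le_inf ((hWcl P i x (PV_mono inf_le_left hx)).2.2 hfx)
      ((hWcl Q i x (PV_mono inf_le_right hx)).2.2 hfx)).trans hmod
  · intro i D hD hDZ hi x hx
    exact ⟨mem_PV.2 ⟨mem_PV.1 (hWmax P i D hD hDZ hi hx), mem_PV.1 (hWmax Q i D hD hDZ hi hx)⟩,
      (hDZ hx).2.1⟩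

theorem main1 [Infinite K] {X : Set (PP K ι)} {n k r : ℕ} (hι : Fintype.card ι = r + 1)
    (hX : IsIntegralVariety X) (hXnd : Nondegenerate X)
    (hn : zdim X = ((n : ℕ∞) : WithBot ℕ∞)) (hlt : k * (n + 1) ≤ r) (h1 : n ≤ 1)
    (w : Fin (k + 1) → PP K ι)
    (hC : ComponentsAreIndepLinear (contactLocus X (Set.range w)) (k + 1)) :
    ComponentsAreIndepLinear (contactLocus X (Set.range fun i : Fin k => w (Fin.castAdd 1 i))) k := by
  obtain ⟨W, hWi, hW⟩ := D5 hn _ hC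
  set a : Fin k → PP K ι := fun i => w (Fin.castAdd 1 i) with ha
  have hcl : ∀ x : PP K ι, IsZClosed ({x} : Set (PP K ι)) := fun x => by
    rw [← PV_submodule]; exact isZClosed_PV _
  refine D7 hn a (fun i => (a i).submodule) ?_ (fun i => {a i}) (fun i => irreducible_singleton _)
    ?_ (fun i => rfl) ?_ ?_
  · exact (hWi.comp (Fin.castAdd_injective k 1)).mono fun i => (hW (Fin.castAdd 1 i)).2.1
  · rintro i _ rfl
    refine ⟨(hW (Fin.castAdd 1 i)).1.1, (hW (Fin.castAdd 1 i)).1.2.1, ?_⟩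
    rw [MM_range]
    exact le_iSup (fun i => TT X (a i)) i
  · intro i D hD hDZ hi x hx
    by_contra hne
    have hsub : zclosure D ⊆ X := zclosure_min hX.1 fun y hy => (hDZ hy).1
    have hDX : zclosure D = X := by
      by_contra hneq
      have hlen : ((2 : ℕ) : ℕ∞) ≤ zdim X := by
        apply Order.le_krullDim_iff.2
        let Y0 : {Y : Set (PP K ι) // IsZClosed Y ∧ IsZIrreducible Y ∧ Y ⊆ zclosure X} :=
          ⟨{a i}, hcl _, irreducible_singleton _, by
            rintro _ rfl; exact subset_zclosure _ (hDZ hi).1⟩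
        let Y1 : {Y : Set (PP K ι) // IsZClosed Y ∧ IsZIrreducible Y ∧ Y ⊆ zclosure X} :=
          ⟨zclosure D, isZClosed_zclosure _, hD.closure, hsub.trans (subset_zclosure _)⟩
        let Y2 : {Y : Set (PP K ι) // IsZClosed Y ∧ IsZIrreducible Y ∧ Y ⊆ zclosure X} :=
          ⟨X, hX.1, hX.2, subset_zclosure _⟩
        have h01 : Y0 < Y1 := by
          refine lt_of_le_of_ne (show ({a i} : Set (PP K ι)) ⊆ zclosure D from ?_) fun h => ?_
          · rintro _ rfl; exact subset_zclosure _ hi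
          · have h' : ({a i} : Set (PP K ι)) = zclosure D := congrArg Subtype.val h
            apply hne
            rw [h']
            exact subset_zclosure _ hx
        have h12 : Y1 < Y2 := by
          refine lt_of_le_of_ne (show zclosure D ⊆ X from hsub) fun h => ?_
          exact hneq (congrArg Subtype.val h)
        exact ⟨⟨2, ![Y0, Y1, Y2], by intro i; fin_cases i; exacts [h01, h12]⟩, rfl⟩
      rw [hn] at hlen
      have : 2 ≤ n := by exact_mod_cast hlen
      omega
    have hXM : X ⊆ PV (MM X (Set.range a)) := by
      rw [← hDX]
      refine zclosure_min (isZClosed_PV _) fun y hy => ?_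
      rw [hDX]
      exact mem_PV.2 ((hDZ hy).2.2 (rep_mem_TT (hDZ hy).1))
    have htop : (⊤ : Submodule K (ι → K)) ≤ MM X (Set.range a) := by
      rw [← hXnd]; exact (vspan_le_iff _ _).2 hXM
    have h3 := Submodule.finrank_mono htop
    rw [finrank_top, Module.finrank_fintype_fun_eq_card, hι, MM_range] at h3
    have h4 := finrank_iSup_le (fun i => TT X (a i))
    have h5 : ∀ i, Module.finrank K (TT X (a i)) = n + 1 := fun i => (hW (Fin.castAdd 1 i)).1.2.1
    simp only [h5] at h4
    simp at h4
    omega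
  · intro i
    rw [zclosure_eq (hcl _), PV_submodule]

theorem final {K : Type*} [Field K] [IsAlgClosed K] [CharZero K]
    {ι : Type*} [Fintype ι] (r n k : ℕ) (hι : Fintype.card ι = r + 1)
    (X : Set (PP K ι)) (hX : IsIntegralVariety X) (hXnd : Nondegenerate X)
    (hXdim : zdim X = ((n : ℕ∞) : WithBot ℕ∞)) (hk : 1 ≤ k)
    (hsec : zdim (secant (k + n) X) =
      ((((k + n) * (n + 1) - 1 : ℕ) : ℕ∞) : WithBot ℕ∞))
    (hlt : (k + n) * (n + 1) - 1 < r)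
    (hΓ : HoldsForGeneralTuples X (k + 1) fun u =>
      ComponentsAreIndepLinear (contactLocus X (Set.range u)) (k + 1)) :
    HoldsForGeneralTuples X k fun u =>
      ComponentsAreIndepLinear (contactLocus X (Set.range u)) k := by
  haveI : Infinite K := CharZero.infinite K
  have hirr := hX.2
  rw [holds_iff_gen hirr] at hΓ ⊢
  have hpos : 1 ≤ (k + n) * (n + 1) := Nat.mul_pos (by omega) (by omega)
  by_cases h2 : 2 ≤ n
  · have hT : Gen X (k + n) (fun w => (k + n) * (n + 1) ≤
        Module.finrank K (⨆ p, TT X (w p) : Submodule K (ι → K))) := by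
      obtain ⟨g, hg, h⟩ := terracini hirr (k + n) _ hsec.ge
      refine ⟨g, hg, fun v hv h0 hne => ?_⟩
      have := h v hv hne
      have h3 : ∀ p, TT X (Projectivization.mk K (v p) (h0 p)) = That X (v p) := fun p =>
        TT_eq X (mem_mk_submodule (h0 p)) (h0 p)
      have h4 : (⨆ p, TT X (Projectivization.mk K (v p) (h0 p))) = ⨆ p, That X (v p) :=
        iSup_congr h3
      change _ ≤ Module.finrank K
        (⨆ p, TT X (Projectivization.mk K (v p) (h0 p)) : Submodule K (ι → K))
      rw [h4]
      omega
    have hall : Gen X (k + n) (fun w => ∀ j : Fin n, ComponentsAreIndepLinear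
        (contactLocus X (Set.range fun p => w (eMap k j p))) (k + 1)) :=
      Gen.all hirr fun j => hΓ.comap hirr.1 (eMap k j) (eMap_inj k j)
    refine (Gen.push hirr (hT.and hirr hall)).mono ?_
    rintro u - ⟨w, hw, ⟨hr, hc⟩, hwu⟩
    have := main2 hX.1 hXdim w hr h2 hc
    simpa only [hwu] using this
  · refine (Gen.push hirr hΓ).mono ?_
    rintro u - ⟨w, hw, hc, hwu⟩
    have hle : k * (n + 1) ≤ (k + n) * (n + 1) := Nat.mul_le_mul_right _ (by omega)
    have := main1 (k := k) hι hX hXnd hXdim (by omega) (by omega) w hc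
    simpa only [hwu] using this

/-- **Remark (remspaces).**  Let `X ⊆ ℙ^r` be an integral non-degenerate variety of
dimension `n` (char `0`), weakly `k`-defective, with
`dim σ_{k+n}(X) = (k+n)(n+1) - 1 < r` (so `X` is also weakly `(k+1)`-defective).
If the general tangential contact locus `Γ_{k+1}` is formed by `k+1` linearly
independent linear subspaces, then the general tangential contact locus `Γ_k` is
formed by `k` linearly independent linear subspaces. -/
theorem statement7 {K : Type*} [Field K] [IsAlgClosed K] [CharZero K]
    {ι : Type*} [Fintype ι] (r n k : ℕ) (hι : Fintype.card ι = r + 1)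
    (X : Set (PP K ι)) (hX : IsIntegralVariety X) (hXnd : Nondegenerate X)
    (hXdim : zdim X = ((n : ℕ∞) : WithBot ℕ∞)) (hk : 1 ≤ k)
    (hwd : WeaklyDefective X k)
    (hsec : zdim (secant (k + n) X) =
      ((((k + n) * (n + 1) - 1 : ℕ) : ℕ∞) : WithBot ℕ∞))
    (hlt : (k + n) * (n + 1) - 1 < r)
    (hΓ : HoldsForGeneralTuples X (k + 1) fun u =>
      ComponentsAreIndepLinear (contactLocus X (Set.range u)) (k + 1)) :
    HoldsForGeneralTuples X k fun u =>
      ComponentsAreIndepLinear (contactLocus X (Set.range u)) k := by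
  exact final r n k hι X hX hXnd hXdim hk hsec hlt hΓ

end ContactLoci
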